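/- arXiv:1211.6281 — 6 statements merged into one kernel-verified Lean document; each statement's English description precedes it below -/
import Mathlib

section
/- Let d ≥ 1 and N be natural numbers and let v, w ∈ ℂ^d. The operator M_v ∘ ∂_w on ℂ[X_1,…,X_d] maps the space S_N of homogeneous polynomials of degree N into itself, and the trace of its restriction to S_N equals ⟨w,v⟩ · C(d+N−1, d), where ⟨w,v⟩ = Σ_i w_i v_i and C(·,·) denotes the binomial coefficient. -/
open MvPolynomial

/-- Multiplication by the linear form `ℓ_v = Σᵢ vᵢ Xᵢ` as an endomorphism of
`ℂ[X₁,…,X_d]`. -/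
noncomputable def mulLinForm (d : ℕ) (v : Fin d → ℂ) :
    Module.End ℂ (MvPolynomial (Fin d) ℂ) :=
  LinearMap.mulLeft ℂ (∑ i, MvPolynomial.C (v i) * MvPolynomial.X i)

/-- The constant-coefficient operator `∂_w = Σᵢ wᵢ ∂/∂Xᵢ` on `ℂ[X₁,…,X_d]`. -/
noncomputable def dirDeriv (d : ℕ) (w : Fin d → ℂ) :
    Module.End ℂ (MvPolynomial (Fin d) ℂ) :=
  ∑ i, w i • (MvPolynomial.pderiv i).toLinearMap

theorem coeff_op_aux (d : ℕ) (v w : Fin d → ℂ) (p : MvPolynomial (Fin d) ℂ) (m : Fin d →₀ ℕ) :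
    coeff m ((mulLinForm d v ∘ₗ dirDeriv d w) p) =
      ∑ i, ∑ j, v i * w j * (if i ∈ m.support then
        coeff (m - Finsupp.single i 1 + Finsupp.single j 1) p *
          ((((m - Finsupp.single i 1 : Fin d →₀ ℕ) j : ℕ) : ℂ) + 1) else 0) := by
  simp only [mulLinForm, dirDeriv, LinearMap.comp_apply, LinearMap.mulLeft_apply, Finset.sum_mul,
    coeff_sum, mul_assoc, coeff_C_mul, coeff_X_mul']
  refine Finset.sum_congr rfl fun i _ => ?_
  split_ifs with h
  · simp [coeff_sum, coeff_pderiv, Finset.mul_sum]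
  · simp

theorem degree_shift_aux {d : ℕ} (m : Fin d →₀ ℕ) (i j : Fin d) (h : i ∈ m.support) :
    (m - Finsupp.single i 1 + Finsupp.single j 1).degree = m.degree := by
  have h1 : m - Finsupp.single i 1 + Finsupp.single i 1 = m := by
    apply tsub_add_cancel_of_le
    rw [Finsupp.single_le_iff]
    have := Finsupp.mem_support_iff.1 h
    omega
  conv_rhs => rw [← h1]
  simp

theorem op_mem_aux (d N : ℕ) (v w : Fin d → ℂ) (p : MvPolynomial (Fin d) ℂ)
    (hp : p ∈ homogeneousSubmodule (Fin d) ℂ N) :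
    (mulLinForm d v ∘ₗ dirDeriv d w) p ∈ homogeneousSubmodule (Fin d) ℂ N := by
  rw [mem_homogeneousSubmodule] at *
  intro m hm
  change (Finsupp.weight (fun _ => 1)) m = N
  rw [← Finsupp.degree_eq_weight_one]
  by_contra hne
  apply hm
  rw [coeff_op_aux]
  refine Finset.sum_eq_zero fun i _ => Finset.sum_eq_zero fun j _ => ?_
  split_ifs with h
  · rw [hp.coeff_eq_zero]
    · simp
    · rwa [degree_shift_aux m i j h]
  · simp

theorem coeff_op_monomial_aux (d : ℕ) (v w : Fin d → ℂ) (m : Fin d →₀ ℕ) :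
    coeff m ((mulLinForm d v ∘ₗ dirDeriv d w) (monomial m 1)) =
      ∑ i, w i * v i * (m i : ℂ) := by
  rw [coeff_op_aux]
  refine Finset.sum_congr rfl fun i _ => ?_
  rw [Finset.sum_eq_single i]
  · split_ifs with h
    · have h0 : m i ≠ 0 := Finsupp.mem_support_iff.1 h
      have h1 : m - Finsupp.single i 1 + Finsupp.single i 1 = m := by
        apply tsub_add_cancel_of_le
        rw [Finsupp.single_le_iff]
        omega
      have h2 : (m - Finsupp.single i 1 : Fin d →₀ ℕ) i + 1 = m i := by
        simp; omega
      rw [h1, coeff_monomial, if_pos rfl, one_mul]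
      rw [← h2]; push_cast; ring
    · have h0 : m i = 0 := Finsupp.notMem_support_iff.1 h
      simp [h0]
  · intro j _ hj
    split_ifs with h
    · rw [coeff_monomial, if_neg]
      · simp
      · intro h3
        have h0 : m i ≠ 0 := Finsupp.mem_support_iff.1 h
        have := DFunLike.congr_fun h3 i
        simp [Finsupp.single_apply, hj] at this
        omega
    · simp
  · simp

theorem mem_anti_aux {d N : ℕ} (m : Fin d →₀ ℕ) :
    m ∈ Finset.finsuppAntidiag (Finset.univ : Finset (Fin d)) N ↔ m.degree = N := by
  simp [Finset.mem_finsuppAntidiag, Finsupp.degree_eq_sum]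

/-- Monomial coordinates on the homogeneous submodule. -/
noncomputable def homEquivAux (d N : ℕ) : homogeneousSubmodule (Fin d) ℂ N ≃ₗ[ℂ]
    (Finset.finsuppAntidiag (Finset.univ : Finset (Fin d)) N → ℂ) where
  toFun p m := coeff m.1 p.1
  map_add' p q := by ext; simp
  map_smul' c p := by ext; simp
  invFun f := ⟨∑ m, monomial m.1 (f m), Submodule.sum_mem _ fun m _ =>
    isHomogeneous_monomial _ ((mem_anti_aux _).1 m.2)⟩
  left_inv p := by
    ext m
    simp only [coeff_sum, coeff_monomial]
    by_cases h : m.degree = N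
    · rw [Finset.sum_eq_single ⟨m, (mem_anti_aux _).2 h⟩]
      · simp
      · intro b _ hb
        rw [if_neg]
        exact fun h => hb (Subtype.ext h)
      · simp
    · have hp : p.1.IsHomogeneous N := p.2
      rw [hp.coeff_eq_zero h]
      refine Finset.sum_eq_zero fun b _ => if_neg ?_
      rintro rfl
      exact h ((mem_anti_aux _).1 b.2)
  right_inv f := by
    ext m
    simp only [coeff_sum, coeff_monomial]
    rw [Finset.sum_eq_single m]
    · simp
    · intro b _ hb
      rw [if_neg]
      exact fun h => hb (Subtype.ext h)
    · simp

theorem sum_coord_aux (d N : ℕ) (hd : 1 ≤ d) (i : Fin d) :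
    ∑ m ∈ Finset.finsuppAntidiag (Finset.univ : Finset (Fin d)) N, m i = (d + N - 1).choose d := by
  have hsym : ∀ j : Fin d,
      ∑ m ∈ Finset.finsuppAntidiag (Finset.univ : Finset (Fin d)) N, m j =
      ∑ m ∈ Finset.finsuppAntidiag (Finset.univ : Finset (Fin d)) N, m i := by
    intro j
    refine Finset.sum_bij' (fun m _ => m.equivMapDomain (Equiv.swap i j))
      (fun m _ => m.equivMapDomain (Equiv.swap i j)) ?_ ?_ ?_ ?_ ?_
    · intro m hm
      rw [mem_anti_aux, Finsupp.degree_eq_sum] at *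
      rw [← hm]
      exact Equiv.sum_comp (Equiv.swap i j).symm m
    · intro m hm
      rw [mem_anti_aux, Finsupp.degree_eq_sum] at *
      rw [← hm]
      exact Equiv.sum_comp (Equiv.swap i j).symm m
    · intro m _; ext; simp
    · intro m _; ext; simp
    · intro m _; simp
  have htot : ∑ j : Fin d, ∑ m ∈ Finset.finsuppAntidiag (Finset.univ : Finset (Fin d)) N, m j
      = (d + N - 1).choose N * N := by
    rw [Finset.sum_comm]
    rw [Finset.sum_congr rfl (g := fun _ => N)]
    · rw [Finset.sum_const, Finset.card_finsuppAntidiag_nat_eq_choose]; simp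
    · intro m hm
      rw [mem_anti_aux, Finsupp.degree_eq_sum] at hm
      exact hm
  rw [Finset.sum_congr rfl fun j _ => hsym j] at htot
  simp only [Finset.sum_const, Finset.card_univ, Fintype.card_fin, smul_eq_mul] at htot
  apply Nat.eq_of_mul_eq_mul_left (show 0 < d by omega)
  rw [htot]
  obtain ⟨e, rfl⟩ : ∃ e, d = e + 1 := ⟨d - 1, by omega⟩
  rcases N with _ | n
  · simp
  · have e1 : e + 1 + (n + 1) - 1 = e + n + 1 := by omega
    rw [e1, mul_comm (e + 1)]
    have a := Nat.add_one_mul_choose_eq (e + n) n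
    have b := Nat.add_one_mul_choose_eq (e + n) e
    rw [← a, ← b, Nat.choose_symm_add]

/-- `M_v ∘ ∂_w` preserves the space of homogeneous polynomials of degree `N`,
and the trace of its restriction to that space is `⟨w,v⟩ · C(d+N−1, d)`. -/
theorem trace_mulLinForm_comp_dirDeriv (d N : ℕ) (hd : 1 ≤ d) (v w : Fin d → ℂ) :
    ∃ h : ∀ p ∈ homogeneousSubmodule (Fin d) ℂ N,
        (mulLinForm d v ∘ₗ dirDeriv d w) p ∈ homogeneousSubmodule (Fin d) ℂ N,
      LinearMap.trace ℂ (homogeneousSubmodule (Fin d) ℂ N)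
          ((mulLinForm d v ∘ₗ dirDeriv d w).restrict h) =
        (∑ i, w i * v i) * ((d + N - 1).choose d : ℂ) := by
  refine ⟨op_mem_aux d N v w, ?_⟩
  rw [LinearMap.trace_eq_matrix_trace ℂ (Module.Basis.ofEquivFun (homEquivAux d N)), Matrix.trace]
  have key : ∀ m : Finset.finsuppAntidiag (Finset.univ : Finset (Fin d)) N,
      (LinearMap.toMatrix (Module.Basis.ofEquivFun (homEquivAux d N))
        (Module.Basis.ofEquivFun (homEquivAux d N))
        ((mulLinForm d v ∘ₗ dirDeriv d w).restrict (op_mem_aux d N v w))).diag m =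
      ∑ i, w i * v i * (m.1 i : ℂ) := by
    intro m
    rw [Matrix.diag_apply, LinearMap.toMatrix_apply, Module.Basis.ofEquivFun_repr_apply,
      Module.Basis.coe_ofEquivFun]
    have hb : ((homEquivAux d N).symm (Pi.single m 1)).1 = monomial m.1 1 := by
      change ∑ k : Finset.finsuppAntidiag (Finset.univ : Finset (Fin d)) N,
        monomial k.1 ((Pi.single m 1 : _ → ℂ) k) = _
      rw [Finset.sum_eq_single m]
      · simp
      · intro b _ hb
        simp [hb]
      · simp
    change coeff m.1 ((mulLinForm d v ∘ₗ dirDeriv d w)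
      ((homEquivAux d N).symm (Pi.single m 1)).1) = _
    rw [hb, coeff_op_monomial_aux]
  rw [Finset.sum_congr rfl fun m _ => key m, Finset.sum_comm, Finset.sum_mul]
  refine Finset.sum_congr rfl fun i _ => ?_
  rw [← Finset.mul_sum, ← sum_coord_aux d N hd i, Nat.cast_sum,
    ← Finset.sum_coe_sort (Finset.finsuppAntidiag (Finset.univ : Finset (Fin d)) N)]
end

section
/- Let d ≥ 1 and N be natural numbers and let v, w ∈ ℂ^d. The operator ∂_w ∘ M_v on ℂ[X_1,…,X_d] maps the space S_N of homogeneous polynomials of degree N into itself, and the trace of its restriction to S_N equals ⟨w,v⟩ · C(d+N, d), where ⟨w,v⟩ = Σ_i w_i v_i and C(·,·) denotes the binomial coefficient. -/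
open MvPolynomial

lemma mem_A_iff (d N : ℕ) (a : Fin d →₀ ℕ) :
    a ∈ (Finset.univ : Finset (Fin d)).finsuppAntidiag N ↔ a.degree = N := by
  simp [Finset.mem_finsuppAntidiag, Finsupp.degree_eq_sum]

/-- Coefficient coordinates on homogeneous polynomials. -/
noncomputable def homEquiv (d N : ℕ) :
    homogeneousSubmodule (Fin d) ℂ N ≃ₗ[ℂ]
      (((Finset.univ : Finset (Fin d)).finsuppAntidiag N) → ℂ) where
  toFun p a := coeff a.1 p.1
  map_add' p q := by ext a; simp
  map_smul' c p := by ext a; simp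
  invFun f := ⟨∑ a, monomial a.1 (f a), by
    refine Submodule.sum_mem _ fun a _ => ?_
    exact isHomogeneous_monomial _ ((mem_A_iff d N _).1 a.2)⟩
  left_inv p := by
    classical
    obtain ⟨p, hp⟩ := p
    apply Subtype.ext
    ext m
    simp only [coeff_sum, coeff_monomial]
    by_cases hm : m.degree = N
    · rw [Finset.sum_eq_single ⟨m, (mem_A_iff d N m).2 hm⟩]
      · simp
      · intro b _ hb
        rw [if_neg]
        intro h
        exact hb (Subtype.ext h)
      · simp
    · rw [Finset.sum_eq_zero, IsHomogeneous.coeff_eq_zero hp hm]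
      intro b _
      rw [if_neg]
      rintro rfl
      exact hm ((mem_A_iff d N _).1 b.2)
  right_inv f := by
    classical
    ext a
    simp only [coeff_sum, coeff_monomial]
    rw [Finset.sum_eq_single a]
    · simp
    · intro b _ hb
      rw [if_neg]
      intro h
      exact hb (Subtype.ext h)
    · simp

lemma sum_coord_eq (d N : ℕ) (i j : Fin d) :
    ∑ a ∈ (Finset.univ : Finset (Fin d)).finsuppAntidiag N, (a i + 1) =
    ∑ a ∈ (Finset.univ : Finset (Fin d)).finsuppAntidiag N, (a j + 1) := by
  refine Finset.sum_equiv (Finsupp.domCongr (Equiv.swap i j)).toEquiv ?_ ?_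
  · intro a
    simp only [mem_A_iff, Finsupp.degree_eq_sum]
    simp [Equiv.sum_comp (Equiv.swap i j) (fun x => a x)]
  · intro a _
    simp

lemma sum_coord (d N : ℕ) (i : Fin d) :
    ∑ a ∈ (Finset.univ : Finset (Fin d)).finsuppAntidiag N, (a i + 1) = (d + N).choose d := by
  have hd : 0 < d := i.pos
  apply Nat.eq_of_mul_eq_mul_left hd
  have h1 : d * ∑ a ∈ (Finset.univ : Finset (Fin d)).finsuppAntidiag N, (a i + 1) =
      ∑ j : Fin d, ∑ a ∈ (Finset.univ : Finset (Fin d)).finsuppAntidiag N, (a j + 1) := by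
    rw [Finset.sum_congr rfl (fun j _ => sum_coord_eq d N j i)]
    simp
  rw [h1, Finset.sum_comm]
  have h2 : ∀ a ∈ (Finset.univ : Finset (Fin d)).finsuppAntidiag N,
      ∑ j : Fin d, (a j + 1) = N + d := by
    intro a ha
    rw [mem_A_iff, Finsupp.degree_eq_sum] at ha
    simp [Finset.sum_add_distrib, ha]
  rw [Finset.sum_congr rfl h2, Finset.sum_const, Finset.card_finsuppAntidiag_nat_eq_choose]
  obtain ⟨e, rfl⟩ : ∃ e, d = e + 1 := ⟨d - 1, by omega⟩
  simp only [Finset.card_univ, Fintype.card_fin, smul_eq_mul]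
  have h3 := Nat.add_one_mul_choose_eq (e + N) e
  rw [show e + 1 + N - 1 = e + N by omega, Nat.choose_symm_add.symm,
    show e + 1 + N = e + N + 1 by ring]
  linarith

/-- `∂_w ∘ M_v` preserves the space of homogeneous polynomials of degree `N`,
and the trace of its restriction to that space is `⟨w,v⟩ · C(d+N, d)`. -/
theorem trace_dirDeriv_comp_mulLinForm (d N : ℕ) (hd : 1 ≤ d) (v w : Fin d → ℂ) :
    ∃ h : ∀ p ∈ homogeneousSubmodule (Fin d) ℂ N,
        (dirDeriv d w ∘ₗ mulLinForm d v) p ∈ homogeneousSubmodule (Fin d) ℂ N,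
      LinearMap.trace ℂ (homogeneousSubmodule (Fin d) ℂ N)
          ((dirDeriv d w ∘ₗ mulLinForm d v).restrict h) =
        (∑ i, w i * v i) * ((d + N).choose d : ℂ) := by
  classical
  have h : ∀ p ∈ homogeneousSubmodule (Fin d) ℂ N,
      (dirDeriv d w ∘ₗ mulLinForm d v) p ∈ homogeneousSubmodule (Fin d) ℂ N := by
    intro p hp
    simp only [dirDeriv, mulLinForm, LinearMap.comp_apply, LinearMap.sum_apply,
      LinearMap.smul_apply, LinearMap.mulLeft_apply]
    refine Submodule.sum_mem _ fun i _ => Submodule.smul_mem _ _ ?_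
    have h1 : ((∑ i, C (v i) * X i) * p).IsHomogeneous (1 + N) :=
      (IsHomogeneous.sum _ _ _ fun i _ => isHomogeneous_C_mul_X _ _).mul hp
    have h2 := h1.pderiv (i := i)
    rw [Nat.add_sub_cancel_left] at h2
    exact h2
  refine ⟨h, ?_⟩
  let b := Module.Basis.ofEquivFun (homEquiv d N)
  rw [LinearMap.trace_eq_matrix_trace ℂ b, Matrix.trace]
  have key : ∀ a : ((Finset.univ : Finset (Fin d)).finsuppAntidiag N),
      (LinearMap.toMatrix b b ((dirDeriv d w ∘ₗ mulLinForm d v).restrict h)).diag a =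
      ∑ i, w i * v i * ((a.1 i + 1 : ℕ) : ℂ) := by
    intro a
    have hb : ((b a : homogeneousSubmodule (Fin d) ℂ N) : MvPolynomial (Fin d) ℂ)
        = monomial a.1 1 := by
      have : (b a) = (homEquiv d N).symm (Pi.single a 1) := by
        simp [b, Module.Basis.coe_ofEquivFun]
      rw [this]
      change ∑ c : ((Finset.univ : Finset (Fin d)).finsuppAntidiag N),
        monomial c.1 ((Pi.single a 1 : _ → ℂ) c) = _
      rw [Finset.sum_eq_single a]
      · simp
      · intro c _ hc
        simp [Pi.single_eq_of_ne hc]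
      · simp
    rw [Matrix.diag_apply, LinearMap.toMatrix_apply]
    change coeff a.1 ((dirDeriv d w ∘ₗ mulLinForm d v) (b a).1) = _
    rw [hb]
    simp only [dirDeriv, mulLinForm, LinearMap.comp_apply, LinearMap.sum_apply,
      LinearMap.smul_apply, LinearMap.mulLeft_apply, coeff_sum, coeff_smul]
    refine Finset.sum_congr rfl fun i _ => ?_
    change w i • coeff a.1 (pderiv i _) = _
    rw [coeff_pderiv, Finset.sum_mul, coeff_sum, Finset.sum_eq_single i]
    · rw [mul_assoc, coeff_C_mul, add_comm a.1, coeff_X_mul]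
      simp
      ring
    · intro j _ hj
      rw [mul_assoc, coeff_C_mul, X, monomial_mul, coeff_monomial, if_neg, mul_zero]
      intro he
      have := DFunLike.congr_fun he j
      simp [Finsupp.single_apply, hj, hj.symm] at this
    · simp
  rw [Finset.sum_congr rfl fun a _ => key a, Finset.sum_comm, Finset.sum_mul]
  refine Finset.sum_congr rfl fun i _ => ?_
  rw [← Finset.mul_sum, ← sum_coord d N i, Nat.cast_sum,
    ← Finset.sum_coe_sort ((Finset.univ : Finset (Fin d)).finsuppAntidiag N)
      (fun a => ((a i + 1 : ℕ) : ℂ))]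
end

section
/- Let d ≥ 1, m ≥ 1 and N be natural numbers, and let v_1,…,v_m, w_1,…,w_m ∈ ℂ^d. The operator P = (M_{v_1} ∘ ∂_{w_1}) ∘ (M_{v_2} ∘ ∂_{w_2}) ∘ ⋯ ∘ (M_{v_m} ∘ ∂_{w_m}) on ℂ[X_1,…,X_d] maps the space S_N of homogeneous polynomials of degree N into itself, and the trace of its restriction to S_N equals Σ_{σ ∈ Sym(m)} C(d + ρ(σ) + N − 1, d + m − 1) · ∏_{i=1}^m ⟨w_{σ(i)}, v_i⟩, where the sum is over all permutations σ of {1,…,m}, ρ(σ) is the number of indices i with σ(i) < i, ⟨w,v⟩ = Σ_j w_j v_j, and C(·,·) denotes the binomial coefficient. -/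
open MvPolynomial

namespace TrAux

/-- exponents of total degree `z` -/
noncomputable def D (d : ℕ) (z : ℤ) : Finset (Fin d →₀ ℕ) :=
  if 0 ≤ z then Finset.finsuppAntidiag Finset.univ z.toNat else ∅

abbrev H {d : ℕ} (p : MvPolynomial (Fin d) ℂ) (z : ℤ) : Prop :=
  IsWeightedHomogeneous (fun _ : Fin d => (1 : ℤ)) p z

lemma weight_eq {d : ℕ} (s : Fin d →₀ ℕ) :
    Finsupp.weight (fun _ : Fin d => (1 : ℤ)) s = ((∑ i, s i : ℕ) : ℤ) := by
  simp [Finsupp.weight_apply, Finsupp.sum_fintype]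

lemma mem_D {d : ℕ} {z : ℤ} {s : Fin d →₀ ℕ} :
    s ∈ D d z ↔ Finsupp.weight (fun _ : Fin d => (1 : ℤ)) s = z := by
  rw [weight_eq, D]
  split_ifs with h
  · simp only [Finset.mem_finsuppAntidiag, Finset.subset_univ, and_true]
    change ∑ i, s i = _ ↔ _
    omega
  · simp only [Finset.notMem_empty, false_iff]
    omega

noncomputable def tr (d : ℕ) (z : ℤ) (A : Module.End ℂ (MvPolynomial (Fin d) ℂ)) : ℂ :=
  ∑ s ∈ D d z, coeff s (A (monomial s 1))

lemma tr_add (d z A B) : tr d z (A + B) = tr d z A + tr d z B := by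
  simp [tr, Finset.sum_add_distrib]

lemma tr_smul (d z) (c : ℂ) (A) : tr d z (c • A) = c * tr d z A := by
  simp [tr, Finset.mul_sum]

lemma tr_sum {α : Type*} (d z) (s : Finset α) (A : α → Module.End ℂ (MvPolynomial (Fin d) ℂ)) :
    tr d z (∑ a ∈ s, A a) = ∑ a ∈ s, tr d z (A a) := by
  classical
  induction s using Finset.induction_on with
  | empty => simp [tr]
  | insert a s ha ih => rw [Finset.sum_insert ha, Finset.sum_insert ha, tr_add, ih]

lemma tr_neg (d : ℕ) (z : ℤ) (hz : z < 0) (A) : tr d z A = 0 := by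
  simp [tr, D, not_le.2 hz]

lemma tr_one (e n : ℕ) : tr (e + 1) n 1 = ((e + n).choose e : ℂ) := by
  simp only [tr, Module.End.one_apply, coeff_monomial, if_true, Finset.sum_const, nsmul_eq_mul,
    mul_one, D]
  rw [if_pos (by positivity)]
  rw [Int.toNat_natCast, Finset.card_finsuppAntidiag_nat_eq_choose]
  simp only [Finset.card_univ, Fintype.card_fin]
  rw [show e + 1 + n - 1 = n + e by omega, Nat.choose_symm_add, add_comm n e]

lemma H_expand {d : ℕ} {z : ℤ} {p : MvPolynomial (Fin d) ℂ} (hp : H p z) :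
    p = ∑ u ∈ D d z, coeff u p • monomial u 1 := by
  ext s
  rw [coeff_sum]
  simp only [coeff_smul, coeff_monomial, smul_eq_mul, mul_ite, mul_one, mul_zero,
    Finset.sum_ite_eq', mem_D]
  split_ifs with h
  · rfl
  · exact hp.coeff_eq_zero s h

lemma H_monomial {d : ℕ} {z : ℤ} {s : Fin d →₀ ℕ} (hs : s ∈ D d z) :
    H (monomial s (1 : ℂ)) z := isWeightedHomogeneous_monomial _ _ _ (mem_D.1 hs)

lemma tr_cyc {d : ℕ} {z z' : ℤ} {A B : Module.End ℂ (MvPolynomial (Fin d) ℂ)}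
    (hA : ∀ p, H p z → H (A p) z') (hB : ∀ p, H p z' → H (B p) z) :
    tr d z (B * A) = tr d z' (A * B) := by
  have h1 : tr d z (B * A) = ∑ s ∈ D d z, ∑ u ∈ D d z',
      coeff u (A (monomial s 1)) * coeff s (B (monomial u 1)) := by
    refine Finset.sum_congr rfl fun s hs => ?_
    rw [Module.End.mul_apply]
    conv_lhs => rw [H_expand (hA _ (H_monomial hs))]
    simp [coeff_sum]
  have h2 : tr d z' (A * B) = ∑ u ∈ D d z', ∑ s ∈ D d z,
      coeff s (B (monomial u 1)) * coeff u (A (monomial s 1)) := by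
    refine Finset.sum_congr rfl fun s hs => ?_
    rw [Module.End.mul_apply]
    conv_lhs => rw [H_expand (hB _ (H_monomial hs))]
    simp [coeff_sum]
  rw [h1, h2, Finset.sum_comm]
  simp only [mul_comm]

lemma H_iff {d N : ℕ} {p : MvPolynomial (Fin d) ℂ} :
    p ∈ homogeneousSubmodule (Fin d) ℂ N ↔ H p N := by
  rw [mem_homogeneousSubmodule]
  constructor
  · intro h s hs
    have := h hs
    rw [weight_eq]
    simp only [Finsupp.weight_apply, Pi.one_apply, smul_eq_mul, mul_one] at this
    rw [Finsupp.sum_fintype _ _ (by simp)] at this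
    exact_mod_cast this
  · intro h s hs
    have := h hs
    rw [weight_eq] at this
    simp only [Finsupp.weight_apply, Pi.one_apply, smul_eq_mul, mul_one]
    rw [Finsupp.sum_fintype _ _ (by simp)]
    exact_mod_cast this

noncomputable def hEquiv (d N : ℕ) : homogeneousSubmodule (Fin d) ℂ N ≃ₗ[ℂ] (D d N → ℂ) where
  toFun p u := coeff u.1 p.1
  map_add' p q := by ext; simp
  map_smul' c p := by ext; simp
  invFun f := ⟨∑ u, f u • monomial u.1 1, Submodule.sum_mem _ fun u _ =>
    Submodule.smul_mem _ _ (H_iff.2 (H_monomial u.2))⟩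
  left_inv p := by
    ext1
    simp only
    rw [Finset.sum_coe_sort (D d N) (fun u => coeff u p.1 • monomial u (1 : ℂ))]
    exact (H_expand (H_iff.1 p.2)).symm
  right_inv f := by
    ext u
    simp only [coeff_sum, coeff_smul, coeff_monomial, smul_eq_mul, mul_ite, mul_one, mul_zero]
    rw [Finset.sum_eq_single u]
    · simp
    · intro b _ hb
      rw [if_neg]
      exact fun h => hb (Subtype.ext h)
    · simp

lemma trace_restrict (d N : ℕ) (A : Module.End ℂ (MvPolynomial (Fin d) ℂ))
    (h : ∀ p ∈ homogeneousSubmodule (Fin d) ℂ N, A p ∈ homogeneousSubmodule (Fin d) ℂ N) :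
    LinearMap.trace ℂ (homogeneousSubmodule (Fin d) ℂ N) (A.restrict h) = tr d N A := by
  classical
  rw [LinearMap.trace_eq_matrix_trace ℂ (Module.Basis.ofEquivFun (hEquiv d N)), Matrix.trace, tr,
    ← Finset.sum_coe_sort (D d N)]
  refine Finset.sum_congr rfl fun u _ => ?_
  have hb : ((Module.Basis.ofEquivFun (hEquiv d N) u : homogeneousSubmodule (Fin d) ℂ N) :
      MvPolynomial (Fin d) ℂ) = monomial u.1 1 := by
    rw [Module.Basis.coe_ofEquivFun]
    simp only [hEquiv, LinearEquiv.coe_symm_mk']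
    simp [Pi.single_apply, Finset.sum_ite_eq']
  rw [Matrix.diag_apply, LinearMap.toMatrix_apply, Module.Basis.ofEquivFun_repr_apply]
  simp only [hEquiv, LinearEquiv.coe_mk, LinearMap.coe_mk, AddHom.coe_mk, LinearMap.coe_restrict_apply]
  simp only [hEquiv] at hb
  rw [hb]

lemma H_mul {d : ℕ} (v : Fin d → ℂ) {z : ℤ} {p} (hp : H p z) : H (mulLinForm d v p) (z + 1) := by
  rw [mulLinForm, LinearMap.mulLeft_apply, add_comm]
  refine IsWeightedHomogeneous.mul ?_ hp
  refine IsWeightedHomogeneous.sum _ _ _ fun i _ => ?_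
  exact (isWeightedHomogeneous_X ℂ (fun _ : Fin d => (1 : ℤ)) i).C_mul _

lemma H_der {d : ℕ} (w : Fin d → ℂ) {z : ℤ} {p} (hp : H p z) : H (dirDeriv d w p) (z - 1) := by
  rw [dirDeriv, LinearMap.sum_apply]
  refine IsWeightedHomogeneous.sum _ _ _ fun i _ => ?_
  exact (weightedHomogeneousSubmodule ℂ (fun _ : Fin d => (1 : ℤ)) (z - 1)).smul_mem _
    (IsWeightedHomogeneous.pderiv hp (by ring))

lemma comm_rel (d : ℕ) (v w : Fin d → ℂ) : dirDeriv d w * mulLinForm d v =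
    mulLinForm d v * dirDeriv d w + (∑ j, w j * v j) • 1 := by
  refine LinearMap.ext fun p => ?_
  simp only [dirDeriv, mulLinForm, Module.End.mul_apply, LinearMap.add_apply, LinearMap.smul_apply,
    LinearMap.sum_apply, LinearMap.mulLeft_apply, Module.End.one_apply, Derivation.coeFn_coe,
    Derivation.leibniz, smul_eq_mul, smul_add, Finset.sum_add_distrib, Finset.mul_sum, mul_smul_comm]
  congr 1
  rw [Finset.sum_smul]
  refine Finset.sum_congr rfl fun i _ => ?_
  simp only [map_sum, Derivation.leibniz, pderiv_C, pderiv_X, smul_eq_mul, mul_zero, add_zero]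
  rw [Finset.sum_eq_single i]
  · simp only [mul_smul, ← C_mul', Pi.single_eq_same]; ring
  · intro b _ hb
    simp [Pi.single_apply, hb]
  · simp

def er {α : Type*} [DecidableEq α] (l : List α) (a : α) : List α := l.erase a

lemma er_sublist {α : Type*} [DecidableEq α] (l : List α) (a : α) : (er l a).Sublist l :=
  List.erase_sublist

lemma mem_er {α : Type*} [DecidableEq α] {l : List α} (h : l.Nodup) {a b : α} :
    a ∈ er l b ↔ a ≠ b ∧ a ∈ l := h.mem_erase_iff

lemma list_comm {α R : Type*} [DecidableEq α] [Ring R] [Algebra ℂ R] (f : α → R) (x : R) (c : α → ℂ)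
    (h : ∀ a, x * f a = f a * x + c a • 1) (l : List α) (hl : l.Nodup) :
    x * (l.map f).prod = (l.map f).prod * x + ∑ a ∈ l.toFinset, c a • ((er l a).map f).prod := by
  induction l with
  | nil => simp
  | cons b l ih =>
    rw [List.nodup_cons] at hl
    have ih := ih hl.2
    simp only [er] at ih ⊢
    rw [List.map_cons, List.prod_cons, ← mul_assoc, h, add_mul, mul_assoc, ih, List.toFinset_cons,
      Finset.sum_insert (by simpa using hl.1), List.erase_cons_head, mul_add, mul_assoc, add_assoc,
      Finset.mul_sum, smul_mul_assoc, one_mul, add_comm (c b • _)]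
    congr 2
    refine Finset.sum_congr rfl fun a ha => ?_
    rw [List.erase_cons_tail, List.map_cons, List.prod_cons, mul_smul_comm]
    have : a ∈ l := by simpa using ha
    rintro h
    rw [beq_iff_eq] at h
    subst h
    exact hl.1 this

section
variable {d : ℕ} {ι κ : Type}

noncomputable def opl (v : ι → Fin d → ℂ) (w : κ → Fin d → ℂ) :
    ι ⊕ κ → Module.End ℂ (MvPolynomial (Fin d) ℂ) :=
  Sum.elim (fun i => mulLinForm d (v i)) (fun j => dirDeriv d (w j))

def sh : ι ⊕ κ → ℤ := Sum.elim (fun _ => 1) (fun _ => -1)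

lemma H_op (v : ι → Fin d → ℂ) (w : κ → Fin d → ℂ) (l : List (ι ⊕ κ)) {z : ℤ} {p} (hp : H p z) :
    H ((l.map (opl v w)).prod p) (z + (l.map sh).sum) := by
  induction l with
  | nil => simpa using hp
  | cons a l ih =>
    rw [List.map_cons, List.prod_cons, Module.End.mul_apply]
    rcases a with i | j
    · have := H_mul (v i) ih
      simp only [List.map_cons, List.sum_cons]
      rw [show z + (sh (Sum.inl i : ι ⊕ κ) + (List.map sh l).sum) = z + (List.map sh l).sum + 1 by
        simp only [sh, Sum.elim_inl]; ring]
      exact this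
    · have := H_der (w j) ih
      simp only [List.map_cons, List.sum_cons]
      rw [show z + (sh (Sum.inr j : ι ⊕ κ) + (List.map sh l).sum) = z + (List.map sh l).sum - 1 by
        simp only [sh, Sum.elim_inr]; ring]
      exact this

lemma sh_sum [Fintype ι] [Fintype κ] [DecidableEq ι] [DecidableEq κ] (l : List (ι ⊕ κ))
    (hn : l.Nodup) (hm : ∀ a, a ∈ l) :
    (l.map sh).sum = (Fintype.card ι : ℤ) - Fintype.card κ := by
  rw [← List.sum_toFinset _ hn, show l.toFinset = Finset.univ by ext; simp [hm],
    Fintype.sum_sum_type]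
  simp [sh, sub_eq_add_neg]
end

lemma der_comm (d : ℕ) (w w' : Fin d → ℂ) :
    dirDeriv d w * dirDeriv d w' = dirDeriv d w' * dirDeriv d w := by
  have h : ∀ i j : Fin d, Commute ((pderiv i).toLinearMap : Module.End ℂ (MvPolynomial (Fin d) ℂ))
      (pderiv j).toLinearMap := by
    intro i j
    refine LinearMap.ext fun p => ?_
    have : ⁅(pderiv i : Derivation ℂ (MvPolynomial (Fin d) ℂ) (MvPolynomial (Fin d) ℂ)),
        (pderiv j : Derivation ℂ (MvPolynomial (Fin d) ℂ) (MvPolynomial (Fin d) ℂ))⁆ = 0 := by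
      refine MvPolynomial.derivation_ext fun k => ?_
      rw [Derivation.commutator_apply, pderiv_X, pderiv_X]
      simp only [Pi.single_apply]
      split_ifs <;> simp
    have := congrArg (fun D : Derivation ℂ (MvPolynomial (Fin d) ℂ) (MvPolynomial (Fin d) ℂ) => D p) this
    simp only [Derivation.commutator_apply, Derivation.zero_apply] at this
    exact sub_eq_zero.1 this
  change Commute _ _
  unfold dirDeriv
  exact Commute.sum_left _ _ _ fun i _ => Commute.sum_right _ _ _ fun j _ =>
    ((h i j).smul_left _).smul_right _

section
variable {d : ℕ} {ι κ : Type} [DecidableEq ι] [DecidableEq κ]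

def ext (i0 : ι) (j0 : κ) (τ : {i // i ≠ i0} ≃ {j // j ≠ j0}) : ι ≃ κ where
  toFun x := if h : x = i0 then j0 else τ ⟨x, h⟩
  invFun y := if h : y = j0 then i0 else τ.symm ⟨y, h⟩
  left_inv x := by
    by_cases h : x = i0
    · simp [h]
    · simp [h, (τ ⟨x, h⟩).2]
  right_inv y := by
    by_cases h : y = j0
    · simp [h]
    · simp [h, (τ.symm ⟨y, h⟩).2]

lemma ext_self (i0 : ι) (j0 : κ) (τ : {i // i ≠ i0} ≃ {j // j ≠ j0}) : ext i0 j0 τ i0 = j0 := by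
  simp [ext]

lemma ext_ne (i0 : ι) (j0 : κ) (τ : {i // i ≠ i0} ≃ {j // j ≠ j0}) (i : {i // i ≠ i0}) :
    ext i0 j0 τ i = τ i := by
  simp [ext, i.2]

def fib (i0 : ι) (j0 : κ) : ({i // i ≠ i0} ≃ {j // j ≠ j0}) ≃ {σ : ι ≃ κ // σ i0 = j0} where
  toFun τ := ⟨ext i0 j0 τ, ext_self i0 j0 τ⟩
  invFun σ := σ.1.subtypeEquiv (fun a => by
    have h := σ.2
    rw [not_iff_not]
    constructor
    · rintro rfl; exact h
    · intro h'; exact σ.1.injective (h'.trans h.symm))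
  left_inv τ := by
    ext i
    simp [ext_ne]
  right_inv σ := by
    ext i
    by_cases h : i = i0
    · subst h
      simp [ext_self, σ.2]
    · exact congrArg id (ext_ne i0 j0 _ ⟨i, h⟩)

variable [Fintype ι] [Fintype κ]

lemma sum_row (i0 : ι) (F : (ι ≃ κ) → ℂ) :
    ∑ σ, F σ = ∑ j0, ∑ τ, F (ext i0 j0 τ) := by
  rw [← (Equiv.sigmaFiberEquiv (fun σ : ι ≃ κ => σ i0)).sum_comp, Fintype.sum_sigma]
  refine Finset.sum_congr rfl fun j0 _ => ?_
  rw [← (fib i0 j0).sum_comp]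
  rfl

lemma sum_col (j0 : κ) (F : (ι ≃ κ) → ℂ) :
    ∑ σ, F σ = ∑ i0, ∑ τ, F (ext i0 j0 τ) := by
  rw [← (Equiv.sigmaFiberEquiv (fun σ : ι ≃ κ => σ.symm j0)).sum_comp, Fintype.sum_sigma]
  refine Finset.sum_congr rfl fun i0 _ => ?_
  rw [← ((fib i0 j0).trans (Equiv.subtypeEquivRight (q := fun σ : ι ≃ κ => σ.symm j0 = i0)
    fun σ => by rw [Equiv.symm_apply_eq, eq_comm])).sum_comp]
  rfl

def rho (pos : ι ⊕ κ → ℕ) (σ : ι ≃ κ) : ℕ :=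
  ∑ i, if pos (Sum.inr (σ i)) < pos (Sum.inl i) then 1 else 0

abbrev ip (w v : Fin d → ℂ) : ℂ := ∑ j, w j * v j

abbrev emb (i0 : ι) (j0 : κ) : {i // i ≠ i0} ⊕ {j // j ≠ j0} → ι ⊕ κ :=
  Sum.map Subtype.val Subtype.val

lemma rho_ext (pos : ι ⊕ κ → ℕ) (i0 : ι) (j0 : κ) (τ) :
    rho pos (ext i0 j0 τ) =
      (if pos (Sum.inr j0) < pos (Sum.inl i0) then 1 else 0) + rho (pos ∘ emb i0 j0) τ := by
  rw [rho, Fintype.sum_eq_add_sum_subtype_ne _ i0, ext_self, rho]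
  simp only [ext_ne]
  rfl

lemma prod_ext (v : ι → Fin d → ℂ) (w : κ → Fin d → ℂ) (i0 : ι) (j0 : κ) (τ) :
    ∏ i, ip (w (ext i0 j0 τ i)) (v i) =
      ip (w j0) (v i0) * ∏ i : {i // i ≠ i0}, ip (w (τ i)) (v i) := by
  rw [Fintype.prod_eq_mul_prod_subtype_ne _ i0, ext_self]
  simp [ext_ne]

lemma rho_le (pos : ι ⊕ κ → ℕ) (σ : ι ≃ κ) : rho pos σ ≤ Fintype.card ι := by
  rw [rho, Fintype.card_eq_sum_ones]
  exact Finset.sum_le_sum fun i _ => by split_ifs <;> simp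
end

/-- right-hand side -/
noncomputable def rhs (e m n : ℕ) {d : ℕ} {ι κ : Type} [Fintype ι] [Fintype κ] [DecidableEq ι]
    [DecidableEq κ] (v : ι → Fin d → ℂ) (w : κ → Fin d → ℂ) (pos : ι ⊕ κ → ℕ) : ℂ :=
  ∑ σ : ι ≃ κ, ((e + rho pos σ + n).choose (e + m) : ℂ) * ∏ i, ip (w (σ i)) (v i)

lemma rhs_zero (e m : ℕ) {d : ℕ} {ι κ : Type} [Fintype ι] [Fintype κ] [DecidableEq ι]
    [DecidableEq κ] (v : ι → Fin d → ℂ) (w : κ → Fin d → ℂ) (pos : ι ⊕ κ → ℕ)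
    (h : Fintype.card ι = m) : rhs e (m + 1) 0 v w pos = 0 := by
  refine Finset.sum_eq_zero fun σ _ => ?_
  have := rho_le pos σ
  rw [Nat.choose_eq_zero_of_lt (by omega)]
  simp

lemma rhs_succ (e m n : ℕ) {d : ℕ} {ι κ : Type} [Fintype ι] [Fintype κ] [DecidableEq ι]
    [DecidableEq κ] (v : ι → Fin d → ℂ) (w : κ → Fin d → ℂ) (pos : ι ⊕ κ → ℕ) :
    rhs e (m + 1) (n + 1) v w pos = rhs e (m + 1) n v w pos + rhs e m n v w pos := by
  rw [rhs, rhs, rhs, ← Finset.sum_add_distrib]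
  refine Finset.sum_congr rfl fun σ _ => ?_
  rw [← add_assoc, ← add_assoc, Nat.choose_succ_succ]
  push_cast
  ring

theorem main (e : ℕ) (m : ℕ) : ∀ (ι κ : Type) [Fintype ι] [Fintype κ] [DecidableEq ι]
    [DecidableEq κ] (_ : Fintype.card ι = m) (_ : Fintype.card κ = m)
    (v : ι → Fin (e + 1) → ℂ) (w : κ → Fin (e + 1) → ℂ) (pos : ι ⊕ κ → ℕ)
    (l : List (ι ⊕ κ)) (_ : l.Pairwise (fun a b => pos a < pos b)) (_ : ∀ a, a ∈ l) (n : ℕ),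
    tr (e + 1) n (l.map (opl v w)).prod = rhs e m n v w pos := by
  induction m with
  | zero =>
    intro ι κ _ _ _ _ hι hκ v w pos l hl hm n
    have := Fintype.card_eq_zero_iff.1 hι
    have := Fintype.card_eq_zero_iff.1 hκ
    rcases l with _ | ⟨a, l⟩
    · have : Unique (ι ≃ κ) := ⟨⟨Equiv.equivOfIsEmpty ι κ⟩, fun σ => by ext x; exact isEmptyElim x⟩
      rw [List.map_nil, List.prod_nil, tr_one, rhs, Fintype.sum_unique]
      simp [rho]
    · exact isEmptyElim a
  | succ m ih =>
    intro ι κ _ _ _ _ hι hκ v w pos l hl hm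
    have hnd : l.Nodup := hl.imp (fun h => by rintro rfl; exact lt_irrefl _ h)
    have cardι : ∀ i0 : ι, Fintype.card {i // i ≠ i0} = m := fun i0 => by
      rw [Fintype.card_subtype_compl, Fintype.card_subtype_eq, hι]; rfl
    have cardκ : ∀ i0 : κ, Fintype.card {i // i ≠ i0} = m := fun i0 => by
      rw [Fintype.card_subtype_compl, Fintype.card_subtype_eq, hκ]; rfl
    have restr : ∀ (i0 : ι) (j0 : κ) (l1 : List (ι ⊕ κ)), l1.Pairwise (fun a b => pos a < pos b) →
        (∀ a, a ∈ l1 ↔ a ≠ Sum.inl i0 ∧ a ≠ Sum.inr j0) → ∀ n : ℕ,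
        tr (e + 1) n (l1.map (opl v w)).prod =
          rhs e m n (fun i : {i // i ≠ i0} => v i) (fun j : {j // j ≠ j0} => w j)
            (pos ∘ emb i0 j0) := by
      intro i0 j0 l1 h1 h2 n
      have : l1 ∈ Set.range (List.map (emb i0 j0)) := by
        rw [Set.range_list_map]
        rintro a ha
        obtain ⟨h3, h4⟩ := (h2 a).1 ha
        rcases a with i | j
        · exact ⟨Sum.inl ⟨i, fun h => h3 (by rw [h])⟩, rfl⟩
        · exact ⟨Sum.inr ⟨j, fun h => h4 (by rw [h])⟩, rfl⟩
      obtain ⟨l2, rfl⟩ := this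
      rw [← ih _ _ (cardι i0) (cardκ j0) _ _ (pos ∘ emb i0 j0) l2
        (by rw [List.pairwise_map] at h1; exact h1)]
      · rw [List.map_map]
        congr 3
        ext1 a
        rcases a with i | j <;> rfl
      · intro a
        have hinj : Function.Injective (emb i0 j0) :=
          Sum.map_injective.2 ⟨Subtype.val_injective, Subtype.val_injective⟩
        rw [← List.mem_map_of_injective hinj, h2]
        rcases a with i | j
        · simp [i.2]
        · simp [j.2]
    rcases l with _ | ⟨a, l⟩
    · have : Nonempty ι := Fintype.card_pos_iff.1 (by omega)
      exact absurd (hm (Sum.inl (Classical.arbitrary ι))) (by simp)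
    have hsh := sh_sum _ hnd hm
    rw [List.map_cons, List.sum_cons, hι, hκ, sub_self] at hsh
    have hpos : ∀ b ∈ l, pos a < pos b := (List.pairwise_cons.1 hl).1
    have hl' := (List.pairwise_cons.1 hl).2
    have hnd' := (List.nodup_cons.1 hnd)
    rcases a with i0 | j0
    · set T : ℤ → ℂ := fun z => tr (e + 1) z (((Sum.inl i0 :: l : List (ι ⊕ κ)).map (opl v w)).prod) with hT
      set L := (l.map (opl v w)).prod with hL
      have hT' : ∀ z, T z = tr (e + 1) z (mulLinForm (e + 1) (v i0) * L) := fun z => by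
        rw [hT]; simp only [List.map_cons, List.prod_cons]; rfl
      have hcyc : ∀ z, T (z + 1) = tr (e + 1) z (L * mulLinForm (e + 1) (v i0)) := fun z => by
        rw [hT']
        refine tr_cyc (fun p hp => ?_) (fun p hp => H_mul _ hp)
        have := H_op v w l hp
        convert this using 1
        simp only [sh, Sum.elim_inl] at hsh ⊢
        linarith
      have hE : ∀ j (n : ℕ), tr (e + 1) n (((er l (Sum.inr j)).map (opl v w)).prod) =
          rhs e m n (fun i : {i // i ≠ i0} => v i) (fun k : {k // k ≠ j} => w k)
            (pos ∘ emb i0 j) := by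
        intro j n
        refine restr i0 j _ (hl'.sublist (er_sublist _ _)) (fun a => ?_) n
        rw [mem_er hnd'.2]
        have := hm a
        rw [List.mem_cons] at this
        constructor
        · rintro ⟨h1, h2⟩
          exact ⟨fun h => hnd'.1 (h ▸ h2), h1⟩
        · rintro ⟨h1, h2⟩
          exact ⟨h2, this.resolve_left h1⟩
      have hc := list_comm (opl v w) (mulLinForm (e + 1) (v i0))
        (Sum.elim (fun _ => 0) (fun j => - ip (w j) (v i0))) (by
          rintro (i | j)
          · simp only [opl, Sum.elim_inl, zero_smul, add_zero]
            refine LinearMap.ext fun p => ?_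
            simp only [mulLinForm, Module.End.mul_apply, LinearMap.mulLeft_apply]
            ring
          · simp only [opl, Sum.elim_inr, neg_smul, comm_rel]
            abel) l hnd'.2
      have hsum : ∑ a ∈ l.toFinset, (Sum.elim (fun _ => 0) (fun j => - ip (w j) (v i0)) : _ → ℂ) a •
          ((er l a).map (opl v w)).prod = ∑ j, (- ip (w j) (v i0)) •
          ((er l (Sum.inr j)).map (opl v w)).prod := by
        rw [Finset.sum_subset (Finset.subset_univ _), Fintype.sum_sum_type]
        · simp
        · rintro (i | j) _ h
          · simp
          · have := hm (Sum.inr j)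
            simp at this h
            exact absurd this h
      rw [hsum, ← hL] at hc
      have hrec : ∀ n : ℕ, T ((n + 1 : ℕ) : ℤ) = T n + ∑ j, ip (w j) (v i0) *
          rhs e m n (fun i : {i // i ≠ i0} => v i) (fun k : {k // k ≠ j} => w k)
            (pos ∘ emb i0 j) := by
        intro n
        push_cast
        rw [hcyc, hT', hc, tr_add, tr_sum]
        simp only [tr_smul, hE, neg_mul, Finset.sum_neg_distrib]
        ring
      have hR : ∀ n : ℕ, rhs e (m + 1) n v w pos = ∑ j, ip (w j) (v i0) *
          rhs e (m + 1) n (fun i : {i // i ≠ i0} => v i) (fun k : {k // k ≠ j} => w k)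
            (pos ∘ emb i0 j) := by
        intro n
        rw [rhs, sum_row i0]
        refine Finset.sum_congr rfl fun j _ => ?_
        rw [rhs, Finset.mul_sum]
        refine Finset.sum_congr rfl fun τ _ => ?_
        have h1 : pos (Sum.inl i0) < pos (Sum.inr j) :=
          hpos _ (by simpa using hm (Sum.inr j))
        rw [rho_ext, prod_ext, if_neg (by omega), zero_add]
        ring
      intro n
      change T n = _
      rw [hR]
      induction n with
      | zero =>
        have h0 := hcyc (-1)
        rw [tr_neg _ _ (by norm_num)] at h0
        rw [show ((0 : ℕ) : ℤ) = -1 + 1 by norm_num, h0, Finset.sum_eq_zero]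
        intro j _
        rw [rhs_zero _ _ _ _ _ (cardι i0), mul_zero]
      | succ n ihn =>
        rw [hrec, ihn, ← Finset.sum_add_distrib]
        refine Finset.sum_congr rfl fun j _ => ?_
        rw [rhs_succ, mul_add]
    · set T : ℤ → ℂ := fun z => tr (e + 1) z (((Sum.inr j0 :: l : List (ι ⊕ κ)).map (opl v w)).prod) with hT
      set L := (l.map (opl v w)).prod with hL
      have hT' : ∀ z, T z = tr (e + 1) z (dirDeriv (e + 1) (w j0) * L) := fun z => by
        rw [hT]; simp only [List.map_cons, List.prod_cons]; rfl
      have hcyc : ∀ z, T (z - 1) = tr (e + 1) z (L * dirDeriv (e + 1) (w j0)) := fun z => by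
        rw [hT']
        refine tr_cyc (fun p hp => ?_) (fun p hp => H_der _ hp)
        have := H_op v w l hp
        convert this using 1
        simp only [sh, Sum.elim_inr] at hsh ⊢
        linarith
      have hE : ∀ i (n : ℕ), tr (e + 1) n (((er l (Sum.inl i)).map (opl v w)).prod) =
          rhs e m n (fun k : {k // k ≠ i} => v k) (fun k : {k // k ≠ j0} => w k)
            (pos ∘ emb i j0) := by
        intro i n
        refine restr i j0 _ (hl'.sublist (er_sublist _ _)) (fun a => ?_) n
        rw [mem_er hnd'.2]
        have := hm a
        rw [List.mem_cons] at this
        constructor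
        · rintro ⟨h1, h2⟩
          exact ⟨h1, fun h => hnd'.1 (h ▸ h2)⟩
        · rintro ⟨h1, h2⟩
          exact ⟨h1, this.resolve_left h2⟩
      have hc := list_comm (opl v w) (dirDeriv (e + 1) (w j0))
        (Sum.elim (fun i => ip (w j0) (v i)) (fun _ => 0)) (by
          rintro (i | j)
          · simp only [opl, Sum.elim_inl, comm_rel]
          · simp only [opl, Sum.elim_inr, zero_smul, add_zero]
            exact der_comm _ _ _) l hnd'.2
      have hsum : ∑ a ∈ l.toFinset, (Sum.elim (fun i => ip (w j0) (v i)) (fun _ => 0) : _ → ℂ) a •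
          ((er l a).map (opl v w)).prod = ∑ i, (ip (w j0) (v i)) •
          ((er l (Sum.inl i)).map (opl v w)).prod := by
        rw [Finset.sum_subset (Finset.subset_univ _), Fintype.sum_sum_type]
        · simp
        · rintro (i | j) _ h
          · have := hm (Sum.inl i)
            simp at this h
            exact absurd this h
          · simp
      rw [hsum, ← hL] at hc
      have hrec : ∀ n : ℕ, T (n : ℤ) = T ((n : ℤ) - 1) + ∑ i, ip (w j0) (v i) *
          rhs e m n (fun k : {k // k ≠ i} => v k) (fun k : {k // k ≠ j0} => w k)
            (pos ∘ emb i j0) := by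
        intro n
        rw [hcyc, hT', hc, tr_add, tr_sum]
        simp only [tr_smul, hE]
      have hR : ∀ n : ℕ, rhs e (m + 1) n v w pos = ∑ i, ip (w j0) (v i) *
          rhs e (m + 1) (n + 1) (fun k : {k // k ≠ i} => v k) (fun k : {k // k ≠ j0} => w k)
            (pos ∘ emb i j0) := by
        intro n
        rw [rhs, sum_col j0]
        refine Finset.sum_congr rfl fun i _ => ?_
        rw [rhs, Finset.mul_sum]
        refine Finset.sum_congr rfl fun τ _ => ?_
        have h1 : pos (Sum.inr j0) < pos (Sum.inl i) :=
          hpos _ (by simpa using hm (Sum.inl i))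
        rw [rho_ext, prod_ext, if_pos h1, show ∀ x, e + (1 + x) + n = e + x + (n + 1) by
          intro x; ring]
        ring
      have key : ∀ n : ℕ, T ((n : ℤ) - 1) = ∑ i, ip (w j0) (v i) *
          rhs e (m + 1) n (fun k : {k // k ≠ i} => v k) (fun k : {k // k ≠ j0} => w k)
            (pos ∘ emb i j0) := by
        intro n
        induction n with
        | zero =>
          rw [hT', tr_neg _ _ (by norm_num), Finset.sum_eq_zero]
          intro i _
          rw [rhs_zero _ _ _ _ _ (cardι i), mul_zero]
        | succ n ihn =>
          rw [show ((n + 1 : ℕ) : ℤ) - 1 = n by push_cast; ring, hrec, ihn,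
            ← Finset.sum_add_distrib]
          refine Finset.sum_congr rfl fun j _ => ?_
          rw [rhs_succ, mul_add]
      intro n
      change T n = _
      rw [hR, ← key]
      congr 1
      push_cast
      ring

end TrAux

/-- The trace formula for `P = (M_{v₁} ∘ ∂_{w₁}) ∘ ⋯ ∘ (M_{v_m} ∘ ∂_{w_m})` on the
space of homogeneous polynomials of degree `N`:
`tr(P|_{S_N}) = Σ_{σ ∈ Sym(m)} C(d + ρ(σ) + N − 1, d + m − 1) ∏ᵢ ⟨w_{σ(i)}, vᵢ⟩`,
where `ρ(σ) = #{i | σ(i) < i}`. -/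
theorem trace_prod_mulLinForm_comp_dirDeriv (d m N : ℕ) (hd : 1 ≤ d) (hm : 1 ≤ m)
    (v w : Fin m → Fin d → ℂ) :
    ∃ h : ∀ p ∈ homogeneousSubmodule (Fin d) ℂ N,
        (List.ofFn fun i : Fin m => mulLinForm d (v i) * dirDeriv d (w i)).prod p ∈
          homogeneousSubmodule (Fin d) ℂ N,
      LinearMap.trace ℂ (homogeneousSubmodule (Fin d) ℂ N)
          ((List.ofFn fun i : Fin m => mulLinForm d (v i) * dirDeriv d (w i)).prod.restrict h) =
        ∑ σ : Equiv.Perm (Fin m),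
          ((d + (Finset.univ.filter fun i => σ i < i).card + N - 1).choose (d + m - 1) : ℂ) *
            ∏ i, ∑ j, w (σ i) j * v i j := by

  obtain ⟨e, rfl⟩ : ∃ e, d = e + 1 := ⟨d - 1, by omega⟩
  set l : List (Fin m ⊕ Fin m) :=
    (List.ofFn fun i : Fin m => [(Sum.inl i : Fin m ⊕ Fin m), Sum.inr i]).flatten with hl
  have hprod : (List.ofFn fun i : Fin m => mulLinForm (e + 1) (v i) * dirDeriv (e + 1) (w i)).prod =
      (l.map (TrAux.opl v w)).prod := by
    rw [hl, List.map_flatten, List.prod_flatten, List.map_ofFn, List.map_ofFn]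
    refine congrArg (fun f => (List.ofFn f).prod) (funext fun i => ?_)
    simp [TrAux.opl]
  let pos : Fin m ⊕ Fin m → ℕ := Sum.elim (fun i => 2 * i.1) (fun i => 2 * i.1 + 1)
  have hpw : l.Pairwise (fun a b => pos a < pos b) := by
    rw [hl, List.pairwise_flatten]
    constructor
    · intro l' hl'
      rw [List.mem_ofFn] at hl'
      obtain ⟨i, rfl⟩ := hl'
      simp [pos]
    · rw [List.pairwise_ofFn]
      intro i j hij
      have : i.1 < j.1 := hij
      simp [pos]
      omega
  have hmem : ∀ a, a ∈ l := by
    rintro (i | i)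
    · rw [hl, List.mem_flatten]
      exact ⟨_, List.mem_ofFn.2 ⟨i, rfl⟩, by simp⟩
    · rw [hl, List.mem_flatten]
      exact ⟨_, List.mem_ofFn.2 ⟨i, rfl⟩, by simp⟩
  have hnd : l.Nodup := hpw.imp (fun h => by rintro rfl; exact lt_irrefl _ h)
  have hh : ∀ p ∈ homogeneousSubmodule (Fin (e + 1)) ℂ N,
        (List.ofFn fun i : Fin m => mulLinForm (e + 1) (v i) * dirDeriv (e + 1) (w i)).prod p ∈
          homogeneousSubmodule (Fin (e + 1)) ℂ N := by
    intro p hp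
    rw [hprod]
    rw [TrAux.H_iff] at hp ⊢
    have := TrAux.H_op v w l hp
    rwa [TrAux.sh_sum l hnd hmem, sub_self, add_zero] at this
  refine ⟨hh, ?_⟩
  rw [TrAux.trace_restrict, hprod,
    TrAux.main e m (Fin m) (Fin m) (by simp) (by simp) v w pos l hpw hmem N, TrAux.rhs]
  refine Finset.sum_congr rfl fun σ _ => ?_
  have hr : TrAux.rho pos σ = (Finset.univ.filter fun i => σ i < i).card := by
    rw [TrAux.rho, Finset.card_filter]
    refine Finset.sum_congr rfl fun i _ => if_congr ?_ rfl rfl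
    simp only [pos, Sum.elim_inl, Sum.elim_inr, Fin.lt_def]
    omega
  rw [hr]
  congr 3 <;> omega
end

section
/- (Macaulay) Let d ≥ 1 and r ≥ 1 be natural numbers and let B be a set of homogeneous polynomials of degree r in ℂ[X_1,…,X_d] whose only common zero in ℂ^d is the origin (i.e., if x ∈ ℂ^d satisfies b(x) = 0 for all b ∈ B, then x = 0). Then for every N ≥ rd, every homogeneous polynomial of degree N in ℂ[X_1,…,X_d] lies in the ideal generated by B. -/
open MvPolynomial

/-- `a` is a nonzerodivisor modulo `J`. -/
def NzdMod {R : Type*} [CommRing R] (J : Ideal R) (a : R) : Prop := ∀ x, a * x ∈ J → x ∈ J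

lemma nzd_comp {d : ℕ} (J : Ideal (MvPolynomial (Fin d) ℂ)) (hJ : ∀ p ∈ J, ∀ n, homogeneousComponent n p ∈ J)
    (a f : MvPolynomial (Fin d) ℂ) (ha : a.IsHomogeneous 1) (n : ℕ) (hf : f.IsHomogeneous (n+1))
    (h : f ∈ J ⊔ Ideal.span {a}) :
    ∃ g : MvPolynomial (Fin d) ℂ, g.IsHomogeneous n ∧ f - a * g ∈ J := by
  letI := MvPolynomial.gradedAlgebra (σ := Fin d) (R := ℂ)
  obtain ⟨j, hj, y, hy, rfl⟩ := Submodule.mem_sup.1 h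
  obtain ⟨q, rfl⟩ := Ideal.mem_span_singleton'.1 hy
  refine ⟨homogeneousComponent n q, homogeneousComponent_isHomogeneous _ _, ?_⟩
  have h1 : homogeneousComponent (n+1) (q * a) = a * homogeneousComponent n q := by
    have := DirectSum.coe_decompose_mul_add_of_left_mem (homogeneousSubmodule (Fin d) ℂ) (i := 1) (j := n)
      (a := a) (b := q) ha
    rw [add_comm 1 n, mul_comm a q] at this
    have e : ∀ (φ : MvPolynomial (Fin d) ℂ) (i : ℕ),
        ((DirectSum.decompose (homogeneousSubmodule (Fin d) ℂ) φ i : homogeneousSubmodule (Fin d) ℂ i) :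
          MvPolynomial (Fin d) ℂ) = homogeneousComponent i φ :=
      fun φ i => decomposition.decompose'_apply φ i
    rwa [e, e] at this
  have h2 := homogeneousComponent_eq_self hf
  rw [map_add, h1] at h2
  rw [← h2, add_sub_cancel_right]
  exact hJ _ hj _

lemma dim_step {d r s : ℕ} (J : Ideal (MvPolynomial (Fin d) ℂ))
    (hJ : ∀ p ∈ J, ∀ n, homogeneousComponent n p ∈ J)
    (a b : MvPolynomial (Fin d) ℂ) (ha : a.IsHomogeneous 1) (hb : b.IsHomogeneous r)
    (hna : NzdMod J a) (hnb : NzdMod J b)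
    (h : ∀ n, s + 1 ≤ n → ∀ f : MvPolynomial (Fin d) ℂ, f.IsHomogeneous n → f ∈ J ⊔ Ideal.span {a}) :
    ∀ n, s + r ≤ n → ∀ f : MvPolynomial (Fin d) ℂ, f.IsHomogeneous n → f ∈ J ⊔ Ideal.span {b} := by
  let R := MvPolynomial (Fin d) ℂ
  let π : R →ₗ[ℂ] (R ⧸ J) := (Ideal.Quotient.mkₐ ℂ J).toLinearMap
  have hπ : ∀ x, π x = Ideal.Quotient.mk J x := fun _ => rfl
  let M : ℕ → Submodule ℂ (R ⧸ J) := fun n => (homogeneousSubmodule (Fin d) ℂ n).map π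
  have hfin : ∀ n, Module.Finite ℂ (M n) := fun n =>
    Module.Finite.iff_fg.2 ((homogeneousSubmodule_fg (Fin d) ℂ n).map π)
  have hinj : ∀ c, NzdMod J c → Function.Injective (LinearMap.mulLeft ℂ (π c)) := by
    intro c hc
    rw [injective_iff_map_eq_zero]
    intro x hx
    obtain ⟨x, rfl⟩ := Ideal.Quotient.mk_surjective x
    rw [LinearMap.mulLeft_apply, hπ, ← map_mul, Ideal.Quotient.eq_zero_iff_mem] at hx
    rw [Ideal.Quotient.eq_zero_iff_mem]
    exact hc _ hx
  have hle : ∀ c k n, c.IsHomogeneous k → (M n).map (LinearMap.mulLeft ℂ (π c)) ≤ M (n + k) := by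
    rintro c k n hc _ ⟨_, ⟨x, hx, rfl⟩, rfl⟩
    refine ⟨c * x, ?_, ?_⟩
    · rw [add_comm]
      exact IsHomogeneous.mul hc hx
    · simp [hπ]
  have hrank : ∀ n, s ≤ n → Module.finrank ℂ (M n) = Module.finrank ℂ (M (n+1)) := by
    intro n hn
    have : (M n).map (LinearMap.mulLeft ℂ (π a)) = M (n + 1) := by
      refine le_antisymm (hle a 1 n ha) ?_
      rintro _ ⟨f, hf, rfl⟩
      obtain ⟨g, hg, hfg⟩ := nzd_comp J hJ a f ha n hf (h _ (by omega) f hf)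
      refine ⟨π g, ⟨g, hg, rfl⟩, ?_⟩
      rw [LinearMap.mulLeft_apply, hπ, hπ, hπ, ← map_mul]
      exact ((Ideal.Quotient.mk_eq_mk_iff_sub_mem _ _).2 hfg).symm
    rw [← this]
    exact (LinearEquiv.finrank_eq (Submodule.equivMapOfInjective _ (hinj a hna) (M n)))
  have hrank2 : ∀ n k, s ≤ n → Module.finrank ℂ (M n) = Module.finrank ℂ (M (n+k)) := by
    intro n k hn
    induction k with
    | zero => rfl
    | succ k ih => rw [ih, hrank _ (by omega)]; rfl
  intro N hN f hf
  obtain ⟨n, rfl⟩ : ∃ n, N = n + r := ⟨N - r, by omega⟩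
  have heq : (M n).map (LinearMap.mulLeft ℂ (π b)) = M (n + r) := by
    refine Submodule.eq_of_le_of_finrank_eq (hle b r n hb) ?_
    rw [← hrank2 n r (by omega)]
    exact (LinearEquiv.finrank_eq (Submodule.equivMapOfInjective _ (hinj b hnb) (M n))).symm
  have hfm : π f ∈ M (n + r) := ⟨f, hf, rfl⟩
  rw [← heq] at hfm
  obtain ⟨_, ⟨g, hg, rfl⟩, hgf⟩ := hfm
  rw [LinearMap.mulLeft_apply, hπ, hπ, hπ, ← map_mul] at hgf
  have := (Ideal.Quotient.mk_eq_mk_iff_sub_mem _ _).1 hgf.symm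
  have h3 : f = (f - b * g) + b * g := by ring
  rw [h3]
  exact add_mem (Submodule.mem_sup_left this)
    (Submodule.mem_sup_right (Ideal.mul_mem_right _ _ (Ideal.mem_span_singleton_self b)))

lemma exists_nzd {d : ℕ} (B : Set (MvPolynomial (Fin d) ℂ))
    (hzero : ∀ x : Fin d → ℂ, (∀ b ∈ B, MvPolynomial.eval x b = 0) → x = 0)
    (k : Fin d) {ι : Type} [Finite ι] (J : ι → Ideal (MvPolynomial (Fin d) ℂ))
    (hJ : ∀ i, NzdMod (J i) (X k)) :
    ∃ b ∈ Submodule.span ℂ B, ∀ i, NzdMod (J i) b := by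
  classical
  let W := Submodule.span ℂ B
  let PP : Set (Ideal (MvPolynomial (Fin d) ℂ)) :=
    ⋃ i, associatedPrimes (MvPolynomial (Fin d) ℂ) (MvPolynomial (Fin d) ℂ ⧸ J i)
  have hfin : PP.Finite := Set.finite_iUnion fun i => associatedPrimes.finite _ _
  let F : Ideal (MvPolynomial (Fin d) ℂ) → Submodule ℂ W := fun P => (P.restrictScalars ℂ).comap W.subtype
  have hnz : ∀ i c, NzdMod (J i) c ↔ ∀ P ∈ associatedPrimes (MvPolynomial (Fin d) ℂ) (MvPolynomial (Fin d) ℂ ⧸ J i), c ∉ P := by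
    intro i c
    have h := biUnion_associatedPrimes_eq_zero_divisors (MvPolynomial (Fin d) ℂ) (MvPolynomial (Fin d) ℂ ⧸ J i)
    have h' : (∀ P ∈ associatedPrimes (MvPolynomial (Fin d) ℂ) (MvPolynomial (Fin d) ℂ ⧸ J i), c ∉ P) ↔
      c ∉ ⋃ p ∈ associatedPrimes (MvPolynomial (Fin d) ℂ) (MvPolynomial (Fin d) ℂ ⧸ J i), (p : Set (MvPolynomial (Fin d) ℂ)) := by
      simp
    rw [h', h]
    constructor
    · rintro hc ⟨x, hx, hcx⟩
      obtain ⟨x, rfl⟩ := Ideal.Quotient.mk_surjective x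
      apply hx
      rw [Ideal.Quotient.eq_zero_iff_mem]
      apply hc
      rw [← Ideal.Quotient.eq_zero_iff_mem]
      exact hcx
    · intro hc x hx
      by_contra hn
      refine hc ⟨Ideal.Quotient.mk _ x, fun h0 => hn (Ideal.Quotient.eq_zero_iff_mem.1 h0), ?_⟩
      exact Ideal.Quotient.eq_zero_iff_mem.2 hx
  have htop : ⊤ ∉ hfin.toFinset.image F := by
    intro hm
    obtain ⟨P, hP, hPt⟩ := Finset.mem_image.1 hm
    rw [Set.Finite.mem_toFinset] at hP
    obtain ⟨i, hP⟩ := Set.mem_iUnion.1 hP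
    have hprime : P.IsPrime := hP.isPrime
    have hBP : ∀ b ∈ B, b ∈ P := by
      intro b hb
      have : (⟨b, Submodule.subset_span hb⟩ : W) ∈ F P := by rw [hPt]; trivial
      exact this
    refine (hnz i _).1 (hJ i) P hP ?_
    rw [← IsPrime.vanishingIdeal_zeroLocus (K := ℂ) P]
    rw [mem_vanishingIdeal_iff]
    intro x hx
    have : x = 0 := hzero x fun b hb => by
      have := mem_zeroLocus_iff.1 hx b (hBP b hb)
      simpa using this
    simp [this]
  have hne := Subspace.biUnion_ne_univ_of_top_notMem htop
  obtain ⟨b, hb⟩ := (Set.ne_univ_iff_exists_notMem _).1 hne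
  refine ⟨b, b.2, fun i => (hnz i _).2 fun P hP hbP => hb ?_⟩
  refine Set.mem_biUnion (x := F P) ?_ hbP
  simp only [Finset.coe_image, Set.mem_image]
  exact ⟨P, by simpa [PP] using ⟨i, hP⟩, rfl⟩

lemma nzd_swap {R : Type*} [CommRing R] (J : Ideal R) (b c : R) (hc : NzdMod J c)
    (hb : NzdMod (J ⊔ Ideal.span {c}) b) : NzdMod (J ⊔ Ideal.span {b}) c := by
  intro x hx
  obtain ⟨j, hj, y, hy, hxy⟩ := Submodule.mem_sup.1 hx
  obtain ⟨y, rfl⟩ := Ideal.mem_span_singleton'.1 hy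
  have h1 : b * y ∈ J ⊔ Ideal.span {c} := by
    have : b * y = -j + c * x := by rw [← hxy]; ring
    rw [this]
    exact add_mem (Submodule.mem_sup_left (neg_mem hj))
      (Submodule.mem_sup_right (Ideal.mul_mem_right _ _ (Ideal.mem_span_singleton_self c)))
  obtain ⟨j', hj', z, hz, hyz⟩ := Submodule.mem_sup.1 (hb y h1)
  obtain ⟨z, rfl⟩ := Ideal.mem_span_singleton'.1 hz
  have h2 : x - b * z ∈ J := by
    apply hc
    have : c * (x - b * z) = j + b * j' := by
      rw [mul_sub, ← hxy, ← hyz]; ring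
    rw [this]
    exact add_mem hj (Ideal.mul_mem_left _ _ hj')
  have : x = (x - b * z) + b * z := by ring
  rw [this]
  exact add_mem (Submodule.mem_sup_left h2)
    (Submodule.mem_sup_right (Ideal.mul_mem_right _ _ (Ideal.mem_span_singleton_self b)))

lemma span_insert_image {R ι : Type*} [CommRing R] [DecidableEq ι] (c : ι → R) (S : Finset ι) (j : ι) :
    Ideal.span (c '' (insert j S : Finset ι)) = Ideal.span (c '' S) ⊔ Ideal.span {c j} := by
  rw [Finset.coe_insert, Set.image_insert_eq, Ideal.span_insert, sup_comm]

lemma nzd_X {d : ℕ} (S : Finset (Fin d)) (j : Fin d) (hj : j ∉ S) :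
    NzdMod (Ideal.span ((X : Fin d → MvPolynomial (Fin d) ℂ) '' S)) (X j) := by
  intro x hx
  rw [mem_ideal_span_X_image] at hx ⊢
  intro m hm
  obtain ⟨i, hi, hmi⟩ := hx (Finsupp.single j 1 + m) (by
    rw [mem_support_iff, coeff_X_mul]; exact mem_support_iff.1 hm)
  refine ⟨i, hi, ?_⟩
  have : j ≠ i := fun h => hj (h ▸ hi)
  simpa [Finsupp.single_apply, this] using hmi

lemma main_ind {d r : ℕ} (hr : 1 ≤ r) (B : Set (MvPolynomial (Fin d) ℂ))
    (hB : ∀ b ∈ B, b.IsHomogeneous r)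
    (hzero : ∀ x : Fin d → ℂ, (∀ b ∈ B, MvPolynomial.eval x b = 0) → x = 0)
    (T : Finset (Fin d)) :
    ∃ c : Fin d → MvPolynomial (Fin d) ℂ, (∀ i ∈ T, c i ∈ Submodule.span ℂ B) ∧
      (∀ i ∉ T, c i = X i) ∧
      (∀ (S : Finset (Fin d)) (j : Fin d), j ∉ S → NzdMod (Ideal.span (c '' S)) (c j)) ∧
      ∀ n, T.card * (r - 1) + 1 ≤ n → ∀ f : MvPolynomial (Fin d) ℂ, f.IsHomogeneous n →
        f ∈ Ideal.span (c '' (Finset.univ : Finset (Fin d))) := by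
  classical
  have hspan : ∀ b ∈ Submodule.span ℂ B, b.IsHomogeneous r := by
    intro b hb
    have : Submodule.span ℂ B ≤ homogeneousSubmodule (Fin d) ℂ r := Submodule.span_le.2 hB
    exact this hb
  induction T using Finset.induction_on with
  | empty =>
    refine ⟨X, by simp, by simp, nzd_X, ?_⟩
    intro n hn f hf
    rw [mem_ideal_span_X_image]
    intro m hm
    by_contra! hcon
    have : m = 0 := by ext i; simpa using hcon i (by simp)
    have h1 := hf (mem_support_iff.1 hm)
    subst this
    simp at h1
    omega
  | insert k T hk ih =>
    obtain ⟨c, hcB, hcX, hreg, hbd⟩ := ih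
    obtain ⟨b, hbW, hb⟩ := exists_nzd B hzero k
      (ι := {S : Finset (Fin d) // k ∉ S}) (fun S => Ideal.span (c '' (S.1 : Set (Fin d))))
      (fun S => by rw [← hcX k hk]; exact hreg S.1 k S.2)
    have himg : ∀ S : Finset (Fin d), k ∉ S →
        Function.update c k b '' (S : Set (Fin d)) = c '' (S : Set (Fin d)) := by
      intro S hS
      refine Set.image_congr fun i hi => ?_
      rw [Function.update_of_ne]
      rintro rfl
      exact hS hi
    refine ⟨Function.update c k b, ?_, ?_, ?_, ?_⟩
    · intro i hi
      by_cases hik : i = k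
      · subst hik; simpa using hbW
      · rw [Function.update_of_ne hik]
        exact hcB i ((Finset.mem_insert.1 hi).resolve_left hik)
    · intro i hi
      rw [Finset.mem_insert, not_or] at hi
      rw [Function.update_of_ne hi.1]
      exact hcX i hi.2
    · intro S j hj
      by_cases hkS : k ∈ S
      · have hjk : j ≠ k := fun h => hj (h ▸ hkS)
        have hkE : k ∉ S.erase k := Finset.notMem_erase k S
        rw [← Finset.insert_erase hkS, span_insert_image, himg _ hkE, Function.update_self,
          Function.update_of_ne hjk]
        have hjE : j ∉ S.erase k := fun h => hj (Finset.mem_of_mem_erase h)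
        refine nzd_swap _ _ _ (hreg _ j hjE) ?_
        rw [← span_insert_image]
        exact hb ⟨insert j (S.erase k), by simp [hjk.symm]⟩
      · rw [himg S hkS]
        by_cases hjk : j = k
        · subst hjk
          rw [Function.update_self]
          exact hb ⟨S, hkS⟩
        · rw [Function.update_of_ne hjk]
          exact hreg S j hj
    · have hkE : k ∉ Finset.univ.erase k := Finset.notMem_erase k Finset.univ
      have hu : (Finset.univ : Finset (Fin d)) = insert k (Finset.univ.erase k) :=
        (Finset.insert_erase (Finset.mem_univ k)).symm
      rw [hu, span_insert_image, hcX k hk] at hbd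
      rw [hu, span_insert_image, himg _ hkE, Function.update_self]
      intro n hn
      refine dim_step (r := r) (s := T.card * (r - 1)) _ ?_ (X k) b (isHomogeneous_X _ _)
        (hspan b hbW) ?_ (hb ⟨_, hkE⟩) hbd n ?_
      · letI := MvPolynomial.gradedAlgebra (σ := Fin d) (R := ℂ)
        intro p hp n
        refine homogeneousComponent_mem_of_mem (Ideal.homogeneous_span _ _ ?_) hp n
        rintro _ ⟨i, hi, rfl⟩
        by_cases hiT : i ∈ T
        · exact ⟨r, hspan _ (hcB i hiT)⟩
        · rw [hcX i hiT]; exact ⟨1, isHomogeneous_X _ _⟩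
      · rw [← hcX k hk]; exact hreg _ k hkE
      · rw [Finset.card_insert_of_notMem hk, add_mul, one_mul] at hn
        omega

/-- Macaulay's theorem: if `B` is a set of homogeneous polynomials of degree `r`
in `ℂ[X₁,…,X_d]` whose only common zero is the origin, then every homogeneous
polynomial of degree `N ≥ rd` lies in the ideal generated by `B`. -/
theorem macaulay (d r : ℕ) (hd : 1 ≤ d) (hr : 1 ≤ r)
    (B : Set (MvPolynomial (Fin d) ℂ))
    (hB : ∀ b ∈ B, b.IsHomogeneous r)
    (hzero : ∀ x : Fin d → ℂ, (∀ b ∈ B, MvPolynomial.eval x b = 0) → x = 0) :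
    ∀ N : ℕ, r * d ≤ N → ∀ f : MvPolynomial (Fin d) ℂ, f.IsHomogeneous N →
      f ∈ Ideal.span B := by
  intro N hN f hf
  obtain ⟨c, hcB, -, -, hbd⟩ := main_ind hr B hB hzero Finset.univ
  have hle : Ideal.span (c '' (Finset.univ : Finset (Fin d))) ≤ Ideal.span B := by
    rw [Ideal.span_le]
    rintro _ ⟨i, -, rfl⟩
    exact Submodule.span_le_restrictScalars ℂ (MvPolynomial (Fin d) ℂ) B (hcB i (Finset.mem_univ i))
  refine hle (hbd N ?_ f hf)
  obtain ⟨q, rfl⟩ : ∃ q, r = q + 1 := ⟨r - 1, by omega⟩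
  simp only [Finset.card_univ, Fintype.card_fin, Nat.add_sub_cancel]
  have : (q + 1) * d = d * q + d := by ring
  omega
end

section
/- Let d ≥ 1 and r ≥ 1 be natural numbers, set N = rd, and let D = (dim S_N)², where S_N is the space of homogeneous polynomials of degree N in ℂ[X_1,…,X_d] (so dim S_N = C(d+N−1, d−1)). Let A and B be sets of homogeneous polynomials of degree r in ℂ[X_1,…,X_d], each of which has the origin as its only common zero in ℂ^d (i.e., if x ∈ ℂ^d satisfies a(x) = 0 for all a ∈ A then x = 0, and likewise for B). Then there exist a natural number m with 1 ≤ m ≤ D and elements a_1,…,a_m ∈ A and b_1,…,b_m ∈ B such that the operator P = M_{a_1} ∘ b_1(∂) ∘ M_{a_2} ∘ b_2(∂) ∘ ⋯ ∘ M_{a_m} ∘ b_m(∂), which maps S_N into itself, has nonzero trace on S_N. -/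
open MvPolynomial

/-- For `b = Σ_s c_s X^s`, the constant-coefficient differential operator
`b(∂) = Σ_s c_s ∏ᵢ (∂/∂Xᵢ)^{sᵢ}` on `ℂ[X₁,…,X_d]`. -/
noncomputable def diffOp (d : ℕ) (b : MvPolynomial (Fin d) ℂ) :
    Module.End ℂ (MvPolynomial (Fin d) ℂ) :=
  ∑ s ∈ b.support, b.coeff s •
    (List.ofFn fun i : Fin d => ((MvPolynomial.pderiv i).toLinearMap ^ s i)).prod

theorem aux_nilp {V : Type*} [AddCommGroup V] [Module ℂ V] [FiniteDimensional ℂ V]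
    (f : Module.End ℂ V) (h : ∀ k : ℕ, LinearMap.trace ℂ V (f ^ (k+1)) = 0) : IsNilpotent f := by
  have hp : minpoly ℂ f ≠ 0 := minpoly.ne_zero (Algebra.IsIntegral.isIntegral f)
  obtain ⟨q, hq, hnd⟩ := Polynomial.exists_eq_pow_rootMultiplicity_mul_and_not_dvd _ hp (0:ℂ)
  set k := Polynomial.rootMultiplicity 0 (minpoly ℂ f)
  simp only [map_zero, sub_zero] at hq hnd
  have hcop : IsCoprime (Polynomial.X ^ (k+1) : Polynomial ℂ) q :=
    ((Polynomial.irreducible_X.coprime_iff_not_dvd).2 hnd).pow_left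
  obtain ⟨u, v, huv⟩ := hcop
  have h0 : Polynomial.aeval f (Polynomial.X ^ k * q) = 0 := by
    rw [← hq]; exact minpoly.aeval _ _
  set e := Polynomial.aeval f (u * Polynomial.X ^ (k+1)) with he
  have he1 : e + Polynomial.aeval f (v * q) = 1 := by
    rw [he, ← map_add, huv, map_one]
  have hev : e * Polynomial.aeval f (v * q) = 0 := by
    rw [he, ← map_mul, show u * Polynomial.X ^ (k+1) * (v * q)
      = (u * v * Polynomial.X) * (Polynomial.X ^ k * q) by ring, map_mul, h0, mul_zero]
  have hidem : IsIdempotentElem e := by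
    have : e * (e + Polynomial.aeval f (v * q)) = e := by rw [he1, mul_one]
    rw [mul_add, hev, add_zero] at this
    exact this
  have htr : LinearMap.trace ℂ V e = 0 := by
    have : ∀ w : Polynomial ℂ, LinearMap.trace ℂ V (Polynomial.aeval f (w * Polynomial.X ^ (k+1))) = 0 := by
      intro w
      induction w using Polynomial.induction_on' with
      | add p q hp hq => rw [add_mul, map_add, map_add, hp, hq, add_zero]
      | monomial n a =>
        rw [Polynomial.monomial_mul_X_pow, Polynomial.aeval_monomial, ← Algebra.smul_def, map_smul,
          ← add_assoc, h, smul_zero]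
    exact this u
  have hz : e = 0 := (LinearMap.IsIdempotentElem.trace_eq_zero_iff hidem).1 htr
  rw [hz, zero_add] at he1
  refine ⟨k, ?_⟩
  have : f ^ k * Polynomial.aeval f (v * q) = 0 := by
    have : Polynomial.aeval f (v * (Polynomial.X ^ k * q)) = 0 := by rw [map_mul, h0, mul_zero]
    rw [show v * (Polynomial.X ^ k * q) = Polynomial.X ^ k * (v * q) by ring, map_mul, map_pow,
      Polynomial.aeval_X] at this
    exact this
  rwa [he1, mul_one] at this

/-- span of words of length between 1 and k -/
def wordSpan {V : Type*} [AddCommGroup V] [Module ℂ V] (G : Set (Module.End ℂ V)) (k : ℕ) :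
    Submodule ℂ (Module.End ℂ V) :=
  Submodule.span ℂ {x | ∃ l : List (Module.End ℂ V), (∀ g ∈ l, g ∈ G) ∧ 1 ≤ l.length ∧
    l.length ≤ k ∧ l.prod = x}

theorem wordSpan_mono {V : Type*} [AddCommGroup V] [Module ℂ V] (G : Set (Module.End ℂ V)) :
    Monotone (wordSpan G) := by
  intro m n h
  refine Submodule.span_mono ?_
  rintro x ⟨l, h1, h2, h3, h4⟩
  exact ⟨l, h1, h2, h3.trans h, h4⟩

theorem wordSpan_mul_left {V : Type*} [AddCommGroup V] [Module ℂ V] (G : Set (Module.End ℂ V))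
    {g : Module.End ℂ V} (hg : g ∈ G) {k : ℕ} {x : Module.End ℂ V} (hx : x ∈ wordSpan G k) :
    g * x ∈ wordSpan G (k+1) := by
  have : wordSpan G k ≤ (wordSpan G (k+1)).comap (LinearMap.mulLeft ℂ g) := by
    refine Submodule.span_le.2 ?_
    rintro x ⟨l, h1, h2, h3, rfl⟩
    refine Submodule.subset_span ⟨g :: l, ?_, ?_, ?_, ?_⟩
    · simpa [hg] using h1
    · simp
    · simpa using h3
    · simp
  exact this hx

theorem wordSpan_stab {V : Type*} [AddCommGroup V] [Module ℂ V] [FiniteDimensional ℂ V]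
    (G : Set (Module.End ℂ V)) (n : ℕ) :
    wordSpan G n ≤ wordSpan G ((Module.finrank ℂ V)^2) := by
  rcases le_total n ((Module.finrank ℂ V)^2) with h | h
  · exact wordSpan_mono G h
  have key := Nat.stabilises_of_monotone (f := fun k => Module.finrank ℂ (wordSpan G k))
    (b := (Module.finrank ℂ V)^2) (n := n)
    (fun a b hab => Submodule.finrank_mono (wordSpan_mono G hab))
    (fun m => (Submodule.finrank_le _).trans (by rw [Module.finrank_linearMap, sq]))
    (by
      intro m hm
      have heq := Submodule.eq_of_le_of_finrank_eq (wordSpan_mono G (Nat.le_succ m)) hm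
      have : wordSpan G (m+1) = wordSpan G (m+2) := by
        refine le_antisymm (wordSpan_mono G (Nat.le_succ _)) (Submodule.span_le.2 ?_)
        rintro x ⟨l, h1, h2, h3, rfl⟩
        rcases Nat.lt_or_ge (m+1) l.length with h | h
        · cases l with
          | nil => simp at h2
          | cons g l' =>
            simp only [List.length_cons] at h h3
            have : l'.prod ∈ wordSpan G (m+1) :=
              Submodule.subset_span ⟨l', fun g hg => h1 g (List.mem_cons_of_mem _ hg), by omega, by omega, rfl⟩
            rw [← heq] at this
            rw [List.prod_cons]
            exact wordSpan_mul_left G (h1 g List.mem_cons_self) this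
        · exact Submodule.subset_span ⟨l, h1, h2, h, rfl⟩
      show Module.finrank ℂ (wordSpan G (m+1)) = Module.finrank ℂ (wordSpan G (m+2))
      rw [this])
    h
  exact (Submodule.eq_of_le_of_finrank_eq (wordSpan_mono G h) key.symm).symm.le

theorem wordSpan_mul {V : Type*} [AddCommGroup V] [Module ℂ V] [FiniteDimensional ℂ V]
    (G : Set (Module.End ℂ V)) {x y : Module.End ℂ V}
    (hx : x ∈ wordSpan G ((Module.finrank ℂ V)^2)) (hy : y ∈ wordSpan G ((Module.finrank ℂ V)^2)) :
    x * y ∈ wordSpan G ((Module.finrank ℂ V)^2) := by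
  have h := Submodule.mul_mem_mul hx hy
  rw [wordSpan, Submodule.span_mul_span] at h
  refine (Submodule.span_le.2 ?_ : _ ≤ wordSpan G ((Module.finrank ℂ V)^2)) h
  rintro _ ⟨_, ⟨l, h1, h2, h3, rfl⟩, _, ⟨l', h1', h2', h3', rfl⟩, rfl⟩
  refine wordSpan_stab G (l.length + l'.length) (Submodule.subset_span ⟨l ++ l', ?_, ?_, ?_, ?_⟩)
  · intro g hg
    rcases List.mem_append.1 hg with h | h
    exacts [h1 g h, h1' g h]
  · simp; omega
  · simp
  · simp

section
attribute [local instance] LieRing.ofAssociativeRing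

theorem exists_word_trace {V : Type*} [AddCommGroup V] [Module ℂ V] [FiniteDimensional ℂ V]
    [Nontrivial V] (G : Set (Module.End ℂ V))
    (hG : Submodule.span ℂ {x : V | ∃ g ∈ G, ∃ v, g v = x} = ⊤) :
    ∃ l : List (Module.End ℂ V), (∀ g ∈ l, g ∈ G) ∧ 1 ≤ l.length ∧
      l.length ≤ (Module.finrank ℂ V)^2 ∧ LinearMap.trace ℂ V l.prod ≠ 0 := by
  by_contra hcon
  push Not at hcon
  let L : LieSubalgebra ℂ (Module.End ℂ V) :=
    { wordSpan G ((Module.finrank ℂ V)^2) with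
      lie_mem' := by
        intro x y hx hy
        exact Submodule.sub_mem _ (wordSpan_mul G hx hy) (wordSpan_mul G hy hx) }
  have hL : ∀ x, x ∈ L ↔ x ∈ wordSpan G ((Module.finrank ℂ V)^2) := fun x => Iff.rfl
  have htr : ∀ x ∈ L, LinearMap.trace ℂ V x = 0 := by
    intro x hx
    have : wordSpan G ((Module.finrank ℂ V)^2) ≤ LinearMap.ker (LinearMap.trace ℂ V) := by
      refine Submodule.span_le.2 ?_
      rintro x ⟨l, h1, h2, h3, rfl⟩
      exact hcon l h1 h2 h3
    exact this hx
  have hnil : ∀ x ∈ L, IsNilpotent x := by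
    intro x hx
    refine aux_nilp x fun k => htr _ ?_
    induction k with
    | zero => simpa using hx
    | succ k ih => rw [pow_succ]; exact wordSpan_mul G ih hx
  have hN : LieModule.IsNilpotent L V := by
    rw [LieModule.isNilpotent_iff_forall (R := ℂ)]
    intro x
    exact hnil x.1 x.2
  have htop : ∀ k, LieModule.lowerCentralSeries ℂ L V k = ⊤ := by
    intro k
    induction k with
    | zero => simp
    | succ k ih =>
      rw [LieModule.lowerCentralSeries_succ, ih, eq_top_iff, ← LieSubmodule.toSubmodule_le_toSubmodule]
      rw [LieSubmodule.top_toSubmodule, ← hG]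
      refine Submodule.span_le.2 ?_
      rintro _ ⟨g, hg, v, rfl⟩
      have hgL : g ∈ L := by
        rw [hL]
        refine wordSpan_stab G 1 (Submodule.subset_span ⟨[g], ?_, ?_, ?_, ?_⟩) <;> simp [hg]
      exact LieSubmodule.lie_mem_lie (x := (⟨g, hgL⟩ : L)) (m := v) trivial trivial
  obtain ⟨k, hk⟩ := (LieModule.isNilpotent_iff ℂ L V).1 hN
  rw [htop] at hk
  exact top_ne_bot hk

end
/-- multi-index factorial -/
noncomputable def mfac {d : ℕ} (α : Fin d →₀ ℕ) : ℂ := ∏ i, ((α i).factorial : ℂ)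

theorem mfac_ne_zero {d : ℕ} (α : Fin d →₀ ℕ) : mfac α ≠ 0 :=
  Finset.prod_ne_zero_iff.2 fun i _ => by exact_mod_cast (α i).factorial_ne_zero

theorem mfac_sub {d : ℕ} (α : Fin d →₀ ℕ) (i : Fin d) (h : α i ≠ 0) :
    mfac α = (α i : ℂ) * mfac (α - Finsupp.single i 1) := by
  unfold mfac
  rw [← Finset.mul_prod_erase _ _ (Finset.mem_univ i),
    ← Finset.mul_prod_erase _ (fun j => (((α - Finsupp.single i 1 : Fin d →₀ ℕ) j).factorial : ℂ)) (Finset.mem_univ i),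
    ← mul_assoc]
  congr 1
  · simp only [Finsupp.coe_tsub, Pi.sub_apply, Finsupp.single_eq_same]
    exact_mod_cast (Nat.mul_factorial_pred h).symm
  · refine Finset.prod_congr rfl fun j hj => ?_
    have : j ≠ i := Finset.ne_of_mem_erase hj
    simp [this.symm]

/-- apolar pairing -/
noncomputable def apair (d : ℕ) (q : MvPolynomial (Fin d) ℂ) : MvPolynomial (Fin d) ℂ →ₗ[ℂ] ℂ :=
  (MvPolynomial.basisMonomials (Fin d) ℂ).constr ℂ fun α => mfac α * coeff α q

theorem apair_monomial {d : ℕ} (q : MvPolynomial (Fin d) ℂ) (α : Fin d →₀ ℕ) (c : ℂ) :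
    apair d q (monomial α c) = c * (mfac α * coeff α q) := by
  have h1 : monomial α c = c • MvPolynomial.basisMonomials (Fin d) ℂ α := by
    simp [MvPolynomial.smul_monomial]
  rw [h1, map_smul, apair, Module.Basis.constr_basis, smul_eq_mul]

theorem apair_sum {d : ℕ} {ι : Type*} (s : Finset ι) (c : ι → ℂ) (q : ι → MvPolynomial (Fin d) ℂ)
    (p : MvPolynomial (Fin d) ℂ) :
    apair d (∑ i ∈ s, c i • q i) p = ∑ i ∈ s, c i * apair d (q i) p := by
  induction p using MvPolynomial.induction_on' with
  | monomial α a =>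
    simp only [apair_monomial, coeff_sum, coeff_smul, smul_eq_mul, Finset.mul_sum]
    exact Finset.sum_congr rfl fun i _ => by ring
  | add p q hp hq => simp only [map_add, hp, hq, mul_add, Finset.sum_add_distrib]

theorem apair_pderiv {d : ℕ} (i : Fin d) (p q : MvPolynomial (Fin d) ℂ) :
    apair d q (pderiv i p) = apair d (X i * q) p := by
  induction p using MvPolynomial.induction_on' with
  | monomial α a =>
    rw [pderiv_monomial, apair_monomial, apair_monomial, coeff_X_mul']
    by_cases h : α i = 0
    · simp [h]
    · rw [if_pos (Finsupp.mem_support_iff.2 h), mfac_sub α i h]; ring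
  | add p q hp hq => simp only [map_add, hp, hq]

theorem apair_pderiv_pow {d : ℕ} (i : Fin d) (n : ℕ) (p q : MvPolynomial (Fin d) ℂ) :
    apair d q (((pderiv i).toLinearMap ^ n : Module.End ℂ (MvPolynomial (Fin d) ℂ)) p)
      = apair d (X i ^ n * q) p := by
  induction n generalizing q with
  | zero => simp
  | succ n ih =>
    rw [pow_succ', Module.End.mul_apply]
    refine (apair_pderiv i _ q).trans ?_
    rw [ih, pow_succ, mul_assoc]

theorem apair_list {d : ℕ} (s : Fin d →₀ ℕ) (l : List (Fin d)) (p q : MvPolynomial (Fin d) ℂ) :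
    apair d q ((l.map fun i => ((pderiv i).toLinearMap ^ s i :
      Module.End ℂ (MvPolynomial (Fin d) ℂ))).prod p)
      = apair d ((l.map fun i => (X i ^ s i : MvPolynomial (Fin d) ℂ)).prod * q) p := by
  induction l generalizing q with
  | nil => simp
  | cons i l ih =>
    rw [List.map_cons, List.prod_cons, Module.End.mul_apply, apair_pderiv_pow, ih, List.map_cons,
      List.prod_cons]
    congr 2; ring

theorem apair_diffOp {d : ℕ} (b p q : MvPolynomial (Fin d) ℂ) :
    apair d q (diffOp d b p) = apair d (b * q) p := by
  have h : b * q = ∑ s ∈ b.support, b.coeff s • (monomial s 1 * q) := by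
    conv_lhs => rw [b.as_sum, Finset.sum_mul]
    refine Finset.sum_congr rfl fun s _ => ?_
    rw [← smul_mul_assoc, smul_monomial, smul_eq_mul, mul_one]
  rw [h, apair_sum, diffOp, LinearMap.sum_apply, map_sum]
  refine Finset.sum_congr rfl fun s _ => ?_
  rw [LinearMap.smul_apply, map_smul, smul_eq_mul, List.ofFn_eq_map, apair_list, ← List.ofFn_eq_map,
    List.prod_ofFn, monomial_eq, map_one, one_mul, Finsupp.prod_fintype _ _ (by simp)]

theorem hom_pderiv_pow {d : ℕ} (i : Fin d) (k : ℕ) (p : MvPolynomial (Fin d) ℂ) (n : ℕ)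
    (hp : p.IsHomogeneous n) :
    (((pderiv i).toLinearMap ^ k : Module.End ℂ (MvPolynomial (Fin d) ℂ)) p).IsHomogeneous (n - k) := by
  induction k with
  | zero => simpa
  | succ k ihk =>
    rw [pow_succ', Module.End.mul_apply, ← Nat.sub_sub]
    exact ihk.pderiv

theorem hom_list {d : ℕ} (s : Fin d →₀ ℕ) (l : List (Fin d)) (p : MvPolynomial (Fin d) ℂ) (n : ℕ)
    (hp : p.IsHomogeneous n) :
    ((l.map fun i => ((pderiv i).toLinearMap ^ s i :
      Module.End ℂ (MvPolynomial (Fin d) ℂ))).prod p).IsHomogeneous (n - (l.map s).sum) := by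
  induction l with
  | nil => simpa
  | cons i l ih =>
    rw [List.map_cons, List.prod_cons, Module.End.mul_apply, List.map_cons, List.sum_cons,
      add_comm, ← Nat.sub_sub]
    exact hom_pderiv_pow i (s i) _ _ ih

theorem hom_diffOp {d r n : ℕ} {b p : MvPolynomial (Fin d) ℂ} (hb : b.IsHomogeneous r)
    (hp : p.IsHomogeneous n) : (diffOp d b p).IsHomogeneous (n - r) := by
  rw [diffOp, LinearMap.sum_apply]
  refine IsHomogeneous.sum _ _ _ fun s hs => ?_
  rw [LinearMap.smul_apply, smul_eq_C_mul]
  refine IsHomogeneous.C_mul ?_ _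
  have := hom_list s (List.finRange d) p n hp
  rw [← List.ofFn_eq_map, ← List.ofFn_eq_map, List.sum_ofFn] at this
  have h2 : ∑ i, s i = r := by
    rw [← Finsupp.degree_eq_sum]
    exact (hb.degree_eq_sum_deg_support hs).symm
  rwa [h2] at this

theorem diffOp_surj {d r n : ℕ} {b : MvPolynomial (Fin d) ℂ} (hb : b.IsHomogeneous r) (hb0 : b ≠ 0)
    (g : MvPolynomial (Fin d) ℂ) (hg : g.IsHomogeneous n) :
    ∃ p : MvPolynomial (Fin d) ℂ, p.IsHomogeneous (n + r) ∧ diffOp d b p = g := by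
  by_contra hcon
  have hmem : g ∉ (homogeneousSubmodule (Fin d) ℂ (n + r)).map (diffOp d b) := by
    rintro ⟨p, hp, rfl⟩
    exact hcon ⟨p, hp, rfl⟩
  obtain ⟨ψ, hψg, hψ⟩ := Submodule.exists_le_ker_of_notMem hmem
  let T : Finset (Fin d →₀ ℕ) := Finset.finsuppAntidiag Finset.univ n
  have hT : ∀ α, α ∈ T ↔ α.degree = n := by
    intro α; simp [T, Finset.mem_finsuppAntidiag, Finsupp.degree_eq_sum]
  let q : MvPolynomial (Fin d) ℂ := ∑ α ∈ T, monomial α (ψ (monomial α 1) / mfac α)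
  have hqc : ∀ α, coeff α q = if α.degree = n then ψ (monomial α 1) / mfac α else 0 := by
    intro α
    simp only [q, coeff_sum, coeff_monomial, Finset.sum_ite_eq', hT]
  have hqh : q.IsHomogeneous n := by
    refine IsHomogeneous.sum _ _ _ fun α hα => isHomogeneous_monomial _ ((hT α).1 hα)
  have hpair : ∀ p : MvPolynomial (Fin d) ℂ, p.IsHomogeneous n → apair d q p = ψ p := by
    intro p hp
    rw [p.as_sum, map_sum, map_sum]
    refine Finset.sum_congr rfl fun α hα => ?_
    have hd : α.degree = n := by
      exact (hp.degree_eq_sum_deg_support hα).symm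
    rw [apair_monomial, hqc, if_pos hd, mul_div_cancel₀ _ (mfac_ne_zero α), ← smul_eq_mul, ← map_smul,
      smul_monomial, smul_eq_mul, mul_one]
  have hbq : b * q = 0 := by
    ext α
    by_cases hα : α.degree = r + n
    · have h1 : apair d (b * q) (monomial α 1) = 0 := by
        have hm : (monomial α (1:ℂ)).IsHomogeneous (n + r) := isHomogeneous_monomial _ (by omega)
        rw [← apair_diffOp, hpair]
        · exact hψ ⟨_, hm, rfl⟩
        · simpa using hom_diffOp hb hm
      rw [apair_monomial, one_mul] at h1
      simpa [mfac_ne_zero] using h1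
    · rw [(hb.mul hqh).coeff_eq_zero hα, coeff_zero]
  have hq0 : q = 0 := (mul_eq_zero.1 hbq).resolve_left hb0
  apply hψg
  rw [← hpair g hg, hq0]
  have := apair_sum (d := d) (∅ : Finset ℕ) (fun _ => 0) (fun _ => 0) g
  simpa using this
theorem exists_ge_of_sum {d M : ℕ} (hd : 1 ≤ d) (α : Fin d →₀ ℕ) (h : d * M ≤ α.degree) :
    ∃ j, M ≤ α j := by
  by_contra hcon
  push Not at hcon
  rw [Finsupp.degree_eq_sum] at h
  have : ∑ i, α i < ∑ _i : Fin d, M :=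
    Finset.sum_lt_sum_of_nonempty ⟨⟨0, hd⟩, Finset.mem_univ _⟩ fun i _ => hcon i
  simp at this
  omega

theorem pow_le_span_pow {R : Type*} [CommRing R] {d : ℕ} (hd : 1 ≤ d) (v : Fin d → R) (q : ℕ) :
    (Ideal.span (Set.range v)) ^ (d * q) ≤ Ideal.span (Set.range fun i => v i ^ q) := by
  intro y hy
  obtain ⟨p, hp, rfl⟩ := (Ideal.mem_span_pow_iff_exists_isHomogeneous v y).1 hy
  rw [eval_eq]
  refine Ideal.sum_mem _ fun α hα => Ideal.mul_mem_left _ _ ?_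
  obtain ⟨j, hj⟩ := exists_ge_of_sum hd α (hp.degree_eq_sum_deg_support hα).le
  rw [← Finsupp.prod, Finsupp.prod_fintype _ _ (by simp),
    ← Finset.mul_prod_erase _ _ (Finset.mem_univ j)]
  refine Ideal.mul_mem_right _ _ ?_
  rw [← Nat.add_sub_of_le hj, pow_add]
  exact Ideal.mul_mem_right _ _ (Ideal.subset_span ⟨j, rfl⟩)

theorem vars_pow_le {K : Type*} [CommRing K] {d r M : ℕ} (hd : 1 ≤ d) (hrM : r ≤ M)
    (I : Ideal (MvPolynomial (Fin d) K))
    (h : ∀ j, (X j : MvPolynomial (Fin d) K) ^ M ∈ idealOfVars (Fin d) K ^ (M - r) * I) :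
    idealOfVars (Fin d) K ^ (d * M) ≤ idealOfVars (Fin d) K ^ (d * M - r) * I := by
  have hM : M ≤ d * M := Nat.le_mul_of_pos_left M hd
  rw [pow_idealOfVars_eq_span, Ideal.span_le]
  rintro _ ⟨α, hα, rfl⟩
  have hα' : α.degree = d * M := by simpa using hα
  obtain ⟨j, hj⟩ := exists_ge_of_sum hd α hα'.ge
  have hle : Finsupp.single j M ≤ α := by
    rw [Finsupp.single_le_iff]; exact hj
  have h1 : (monomial α (1:K)) = X j ^ M * monomial (α - Finsupp.single j M) 1 := by
    rw [X_pow_eq_monomial, monomial_mul, one_mul, add_tsub_cancel_of_le hle]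
  have h2 : (monomial (α - Finsupp.single j M) (1:K)) ∈ idealOfVars (Fin d) K ^ (d * M - M) := by
    rw [mem_pow_idealOfVars_iff]
    intro x hx
    have := support_monomial_subset hx
    simp only [Finset.mem_singleton] at this
    subst this
    have h3 : (α - Finsupp.single j M).degree + (Finsupp.single j M).degree = α.degree := by
      rw [← map_add, tsub_add_cancel_of_le hle]
    rw [Finsupp.degree_single] at h3
    omega
  show monomial α (1:K) ∈ _
  rw [h1]
  have := Ideal.mul_mem_mul (h j) h2
  rwa [mul_right_comm, ← pow_add, show M - r + (d * M - M) = d * M - r by omega] at this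

theorem vars_pow_le' {K : Type*} [CommRing K] {d r M : ℕ} (hd : 1 ≤ d) (hrM : r ≤ M)
    (I : Ideal (MvPolynomial (Fin d) K))
    (h : ∀ j, (X j : MvPolynomial (Fin d) K) ^ M ∈ idealOfVars (Fin d) K ^ (M - r) * I) (k : ℕ) :
    idealOfVars (Fin d) K ^ (d * M + r * k) ≤ idealOfVars (Fin d) K ^ (d * M) * I ^ k := by
  have hM : M ≤ d * M := Nat.le_mul_of_pos_left M hd
  induction k with
  | zero => simp
  | succ k ih =>
    calc idealOfVars (Fin d) K ^ (d * M + r * (k+1))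
        = idealOfVars (Fin d) K ^ (d * M) * idealOfVars (Fin d) K ^ (r * (k + 1)) := pow_add _ _ _
      _ ≤ (idealOfVars (Fin d) K ^ (d * M - r) * I) * idealOfVars (Fin d) K ^ (r * (k + 1)) :=
          Ideal.mul_mono_left (vars_pow_le hd hrM I h)
      _ = idealOfVars (Fin d) K ^ (d * M + r * k) * I := by
          rw [mul_right_comm, ← pow_add]
          congr 2
          rw [mul_add, mul_one]; omega
      _ ≤ (idealOfVars (Fin d) K ^ (d * M) * I ^ k) * I := Ideal.mul_mono_left ih
      _ = _ := by rw [mul_assoc, ← pow_succ]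

/-- coefficient extraction -/
noncomputable def extr (K : Type*) [Field K] (d q C : ℕ) (i0 : Fin d) :
    MvPolynomial (Fin d) K →ₗ[K] MvPolynomial (Fin d) K :=
  open Classical in
  (MvPolynomial.basisMonomials (Fin d) K).constr K fun α =>
    if ∀ i, α i % q = Finsupp.single i0 C i then
      monomial (Finsupp.mapRange (fun n => n / q) (Nat.zero_div q) α) 1 else 0

open Classical in
theorem extr_monomial (K : Type*) [Field K] (d q C : ℕ) (i0 : Fin d) (α : Fin d →₀ ℕ) (c : K) :
    extr K d q C i0 (monomial α c) = if ∀ i, α i % q = Finsupp.single i0 C i then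
      monomial (Finsupp.mapRange (fun n => n / q) (Nat.zero_div q) α) c else 0 := by
  have h1 : monomial α c = c • MvPolynomial.basisMonomials (Fin d) K α := by
    simp [MvPolynomial.smul_monomial]
  rw [h1, map_smul, extr, Module.Basis.constr_basis]
  split_ifs <;> simp [MvPolynomial.smul_monomial]

theorem frob_extract (K : Type*) [Field K] (p : ℕ) [Fact p.Prime] [CharP K p] [PerfectRing K p]
    {d : ℕ} (e C : ℕ) (hC : C < p ^ e) (i0 : Fin d) (F : Fin d → MvPolynomial (Fin d) K)
    (γ : Fin d →₀ ℕ)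
    (h : monomial (p ^ e • γ + Finsupp.single i0 C) (1:K) ∈
      Ideal.span (Set.range fun i => F i ^ p ^ e)) :
    monomial γ (1:K) ∈ Ideal.span (Set.range F) := by
  classical
  set q := p ^ e with hq
  have hq0 : 0 < q := by omega
  let σ : K →+* K := (iterateFrobeniusEquiv K p e).symm.toRingHom
  have hσ : ∀ t : K, σ (t ^ q) = t := fun t => (iterateFrobeniusEquiv K p e).symm_apply_apply t
  let ψ : MvPolynomial (Fin d) K → MvPolynomial (Fin d) K := fun x =>
    MvPolynomial.map σ (extr K d q C i0 x)
  have hadd : ∀ x y, ψ (x + y) = ψ x + ψ y := fun x y => by simp only [ψ, map_add]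
  have hmono : ∀ α (c : K), ψ (monomial α c) = if ∀ i, α i % q = Finsupp.single i0 C i then
      monomial (Finsupp.mapRange (fun n => n / q) (Nat.zero_div q) α) (σ c) else 0 := by
    intro α c
    simp only [ψ, extr_monomial]
    split_ifs <;> simp [map_monomial]
  have hmul : ∀ x u, ψ (x * u ^ q) = ψ x * u := by
    intro x u
    induction u using MvPolynomial.induction_on' with
    | add u v hu hv =>
      rw [hq, add_pow_char_pow, ← hq, mul_add, hadd, hu, hv, mul_add]
    | monomial β t =>
      induction x using MvPolynomial.induction_on' with
      | add x y hx hy => rw [add_mul, hadd, hx, hy, hadd, add_mul]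
      | monomial α c =>
        rw [monomial_pow, monomial_mul, hmono, hmono]
        have hc : (∀ i, (α + q • β) i % q = Finsupp.single i0 C i) ↔
            (∀ i, α i % q = Finsupp.single i0 C i) := by
          refine forall_congr' fun i => ?_
          simp [Nat.add_mul_mod_self_left]
        by_cases hcase : ∀ i, α i % q = Finsupp.single i0 C i
        · rw [if_pos (hc.2 hcase), if_pos hcase, monomial_mul, map_mul, hσ]
          congr 2
          ext i
          simp [Nat.add_mul_div_left _ _ hq0]
        · rw [if_neg (fun h => hcase (hc.1 h)), if_neg hcase, zero_mul]
  have hγ : ψ (monomial (q • γ + Finsupp.single i0 C) (1:K)) = monomial γ 1 := by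
    rw [hmono, if_pos, map_one]
    · congr 2
      ext i
      simp only [Finsupp.mapRange_apply, Finsupp.coe_add, Finsupp.coe_smul, Pi.add_apply, Pi.smul_apply, smul_eq_mul]
      rw [Nat.mul_add_div hq0, Nat.div_eq_of_lt, add_zero]
      rw [Finsupp.single_apply]; split_ifs <;> omega
    · intro i
      simp only [Finsupp.coe_add, Finsupp.coe_smul, Pi.add_apply, Pi.smul_apply, smul_eq_mul]
      rw [Nat.mul_add_mod, Nat.mod_eq_of_lt]
      rw [Finsupp.single_apply]; split_ifs <;> omega
  obtain ⟨c, hc⟩ := (Ideal.mem_span_range_iff_exists_fun).1 h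
  rw [← hγ, ← hc]
  let ψ' : MvPolynomial (Fin d) K →+ MvPolynomial (Fin d) K := AddMonoidHom.mk' ψ hadd
  have : ψ (∑ i, c i * F i ^ q) = ∑ i, ψ (c i * F i ^ q) := map_sum ψ' _ _
  rw [this]
  refine Ideal.sum_mem _ fun i _ => ?_
  rw [hmul]
  exact Ideal.mul_mem_left _ _ (Ideal.subset_span ⟨i, rfl⟩)

theorem charp_macaulay (K : Type*) [Field K] (p : ℕ) [Fact p.Prime] [CharP K p] [PerfectRing K p]
    {d r M : ℕ} (hd : 1 ≤ d) (hrM : r ≤ M) (F : Fin d → MvPolynomial (Fin d) K)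
    (h : ∀ j, (X j : MvPolynomial (Fin d) K) ^ M ∈
      idealOfVars (Fin d) K ^ (M - r) * Ideal.span (Set.range F))
    (γ : Fin d →₀ ℕ) (hγ : γ.degree = r * d) :
    monomial γ (1:K) ∈ Ideal.span (Set.range F) := by
  obtain ⟨C, hC⟩ : ∃ C, C = d * M := ⟨_, rfl⟩
  obtain ⟨e, hlt⟩ : ∃ e, C < p ^ e := ⟨C, Nat.lt_pow_self (Fact.out : p.Prime).one_lt⟩
  have key : monomial (p ^ e • γ + Finsupp.single ⟨0, hd⟩ C) (1:K) ∈
      idealOfVars (Fin d) K ^ (d * M + r * (d * p ^ e)) := by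
    rw [mem_pow_idealOfVars_iff]
    intro x hx
    have := support_monomial_subset hx
    rw [Finset.mem_singleton] at this
    rw [this, map_add, Finsupp.degree_single, map_nsmul, hγ, smul_eq_mul, hC]
    apply le_of_eq; ring
  have key2 := Ideal.mul_le_right (vars_pow_le' hd hrM _ h _ key)
  exact frob_extract K p e C hlt ⟨0, hd⟩ F γ (pow_le_span_pow hd F _ key2)

lemma jacobson_int : IsJacobsonRing ℤ := by
  rw [isJacobsonRing_iff_prime_eq]
  intro P hP
  by_cases h : P = ⊥
  · subst h
    refine le_antisymm ?_ Ideal.le_jacobson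
    intro x hx
    have h1 := Ideal.mem_jacobson_bot.1 hx x
    rw [Int.isUnit_iff] at h1
    rw [Ideal.mem_bot]
    rcases h1 with h1 | h1
    · have : x * x = 0 := by linarith
      exact mul_self_eq_zero.1 this
    · nlinarith [mul_self_nonneg x]
  · haveI := hP.isMaximal h
    exact Ideal.jacobson_eq_self_of_isMaximal

theorem exists_hom_charp (Λ : Type) [CommRing Λ] [Nontrivial Λ] [Algebra.FiniteType ℤ Λ] :
    ∃ (p : ℕ) (K : Type) (_ : Field K) (_ : Fact p.Prime) (_ : CharP K p) (_ : PerfectRing K p),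
      Nonempty (Λ →+* K) := by
  obtain ⟨m, hm⟩ := Ideal.exists_maximal Λ
  letI : Field (Λ ⧸ m) := Ideal.Quotient.field m
  haveI : Algebra.FiniteType ℤ (Λ ⧸ m) :=
    Algebra.FiniteType.of_surjective (Ideal.Quotient.mkₐ ℤ m) Ideal.Quotient.mk_surjective
  have hjac : IsJacobsonRing ℤ := jacobson_int
  have hfin : Module.Finite ℤ (Λ ⧸ m) := finite_of_finite_type_of_isJacobsonRing ℤ (Λ ⧸ m)
  haveI : Algebra.IsIntegral ℤ (Λ ⧸ m) := Algebra.IsIntegral.of_finite ℤ (Λ ⧸ m)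
  obtain ⟨p, hp⟩ := CharP.exists (Λ ⧸ m)
  rcases CharP.char_is_prime_or_zero (Λ ⧸ m) p with h | h
  · haveI : Fact p.Prime := ⟨h⟩
    let K := AlgebraicClosure (Λ ⧸ m)
    haveI : CharP K p := charP_of_injective_algebraMap (algebraMap (Λ ⧸ m) K).injective p
    haveI : ExpChar K p := ExpChar.prime h
    exact ⟨p, K, inferInstance, ⟨h⟩, inferInstance, inferInstance,
      ⟨(algebraMap (Λ ⧸ m) K).comp (Ideal.Quotient.mk m)⟩⟩
  · exfalso
    subst h
    haveI : CharZero (Λ ⧸ m) := CharP.charP_to_charZero _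
    have hinj : Function.Injective (algebraMap ℤ (Λ ⧸ m)) := Int.cast_injective
    exact Int.not_isField (isField_of_isIntegral_of_isField hinj (Field.toIsField _))

theorem complex_macaulay {d r M : ℕ} (hd : 1 ≤ d) (hrM : r ≤ M)
    (f : Fin d → MvPolynomial (Fin d) ℂ) (hf : ∀ i, (f i).IsHomogeneous r)
    (H : Fin d → Fin d → MvPolynomial (Fin d) ℂ) (hH : ∀ j i, (H j i).IsHomogeneous (M - r))
    (hX : ∀ j, (X j : MvPolynomial (Fin d) ℂ) ^ M = ∑ i, H j i * f i)
    (γ : Fin d →₀ ℕ) (hγ : γ.degree = r * d) :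
    monomial γ (1:ℂ) ∈ Ideal.span (Set.range f) := by
  by_contra hcon
  obtain ⟨φ0, hφ0, hker0⟩ := Submodule.exists_le_ker_of_notMem
    (p := (Ideal.span (Set.range f)).restrictScalars ℂ) (v := monomial γ (1:ℂ)) hcon
  let φ : MvPolynomial (Fin d) ℂ →ₗ[ℂ] ℂ := (φ0 (monomial γ 1))⁻¹ • φ0
  have hφ1 : φ (monomial γ 1) = 1 := inv_mul_cancel₀ hφ0
  have hker : ∀ x ∈ Ideal.span (Set.range f), φ x = 0 := by
    intro x hx
    have : φ0 x = 0 := hker0 hx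
    simp [φ, this]
  let Φ : (Fin d →₀ ℕ) → ℂ := fun α => if α.degree = r * d then φ (monomial α 1) else 0
  have hfinN : {α : Fin d →₀ ℕ | α.degree = r * d}.Finite := by
    refine (Finset.finite_toSet (Finset.finsuppAntidiag Finset.univ (r * d))).subset ?_
    intro α hα
    simpa [Finset.mem_finsuppAntidiag, Finsupp.degree_eq_sum] using hα
  let T : Set ℂ := (⋃ i, ((f i).coeffs : Set ℂ)) ∪ (⋃ j, ⋃ i, ((H j i).coeffs : Set ℂ)) ∪
    (insert 0 (Φ '' {α : Fin d →₀ ℕ | α.degree = r * d}))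
  have hT : T.Finite := by
    refine Set.Finite.union (Set.Finite.union ?_ ?_) ?_
    · exact Set.finite_iUnion fun i => Finset.finite_toSet _
    · exact Set.finite_iUnion fun i => Set.finite_iUnion fun i => Finset.finite_toSet _
    · exact (hfinN.image _).insert _
  let Λ := Algebra.adjoin ℤ T
  have hTΛ : T ⊆ Λ := Algebra.subset_adjoin
  haveI : Algebra.FiniteType ℤ Λ :=
    (Subalgebra.fg_iff_finiteType _).1 ⟨hT.toFinset, by simp [Λ]⟩
  let ι : Λ →+* ℂ := Λ.val.toRingHom
  have hι : Function.Injective ι := Subtype.val_injective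
  have hmapι : Function.Injective (MvPolynomial.map (σ := Fin d) ι) := MvPolynomial.map_injective _ hι
  have hrange : Set.range ι = (Λ : Set ℂ) := Subtype.range_coe
  have hf' : ∀ i, ∃ f' : MvPolynomial (Fin d) Λ, MvPolynomial.map ι f' = f i := by
    intro i
    refine mem_range_map_iff_coeffs_subset.2 ?_
    rw [hrange]
    exact fun x hx => hTΛ (Or.inl (Or.inl (Set.mem_iUnion.2 ⟨i, hx⟩)))
  have hH' : ∀ j i, ∃ f' : MvPolynomial (Fin d) Λ, MvPolynomial.map ι f' = H j i := by
    intro j i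
    refine mem_range_map_iff_coeffs_subset.2 ?_
    rw [hrange]
    exact fun x hx => hTΛ (Or.inl (Or.inr (Set.mem_iUnion.2 ⟨j, Set.mem_iUnion.2 ⟨i, hx⟩⟩)))
  have hΦ' : ∀ α, ∃ x : Λ, ι x = Φ α := by
    intro α
    have : Φ α ∈ T := by
      by_cases h : α.degree = r * d
      · exact Or.inr (Or.inr ⟨α, h, rfl⟩)
      · exact Or.inr (Or.inl (by simp [Φ, h]))
    exact ⟨⟨_, hTΛ this⟩, rfl⟩
  choose f' hf' using hf'
  choose H' hH' using hH'
  choose Φ' hΦ' using hΦ'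
  obtain ⟨p, K, _, _, _, _, ⟨ρ⟩⟩ := exists_hom_charp Λ
  let F : Fin d → MvPolynomial (Fin d) K := fun i => MvPolynomial.map ρ (f' i)
  have hXΛ : ∀ j, (X j : MvPolynomial (Fin d) Λ) ^ M = ∑ i, H' j i * f' i := by
    intro j
    apply hmapι
    simp only [map_pow, map_X, map_sum, map_mul, hf', hH', hX]
  have hXK : ∀ j, (X j : MvPolynomial (Fin d) K) ^ M ∈
      idealOfVars (Fin d) K ^ (M - r) * Ideal.span (Set.range F) := by
    intro j
    have h1 := congrArg (MvPolynomial.map ρ) (hXΛ j)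
    simp only [map_pow, map_X, map_sum, map_mul] at h1
    rw [h1]
    refine Ideal.sum_mem _ fun i _ => Ideal.mul_mem_mul ?_ (Ideal.subset_span ⟨i, rfl⟩)
    have hh : (MvPolynomial.map ρ (H' j i)).IsHomogeneous (M - r) := by
      refine IsHomogeneous.map ?_ ρ
      refine IsHomogeneous.of_map hι ?_
      rw [hH']; exact hH j i
    rw [mem_pow_idealOfVars_iff]
    intro x hx
    exact (hh.degree_eq_sum_deg_support hx).le
  have hmem := charp_macaulay K p hd hrM F hXK γ hγ
  let φK : MvPolynomial (Fin d) K →ₗ[K] K :=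
    (MvPolynomial.basisMonomials (Fin d) K).constr K fun α => ρ (Φ' α)
  have hφK : ∀ α c, φK (monomial α c) = c * ρ (Φ' α) := by
    intro α c
    have h1 : monomial α c = c • MvPolynomial.basisMonomials (Fin d) K α := by
      simp [MvPolynomial.smul_monomial]
    rw [h1, map_smul, smul_eq_mul]
    congr 1
    exact Module.Basis.constr_basis _ _ _ _
  have hrel : ∀ i β, ∑ s ∈ (f' i).support, (f' i).coeff s * Φ' (β + s) = 0 := by
    intro i β
    apply hι
    rw [map_zero, map_sum]
    have hcoe : ∀ s, ι ((f' i).coeff s) = (f i).coeff s := fun s => by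
      rw [← hf', coeff_map]
    simp only [map_mul, hΦ', hcoe]
    have hdeg : ∀ s ∈ (f' i).support, s.degree = r := by
      intro s hs
      have : (f' i).IsHomogeneous r := IsHomogeneous.of_map hι (by rw [hf']; exact hf i)
      exact (this.degree_eq_sum_deg_support hs).symm
    by_cases hβ : β.degree + r = r * d
    · have h2 : φ (monomial β 1 * f i) = 0 :=
        hker _ (Ideal.mul_mem_left _ _ (Ideal.subset_span ⟨i, rfl⟩))
      have hfi : f i = ∑ s ∈ (f' i).support, monomial s ((f i).coeff s) := by
        rw [← hf']
        conv_lhs => rw [(f' i).as_sum, map_sum]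
        refine Finset.sum_congr rfl fun s _ => ?_
        rw [map_monomial, coeff_map]
      rw [← h2]
      conv_rhs => rw [hfi, Finset.mul_sum, map_sum]
      refine Finset.sum_congr rfl fun s hs => ?_
      have : (β + s).degree = r * d := by rw [map_add, hdeg s hs, hβ]
      simp only [Φ, if_pos this]
      rw [monomial_mul, one_mul, ← smul_eq_mul, ← map_smul, smul_monomial, smul_eq_mul, mul_one]
    · refine Finset.sum_eq_zero fun s hs => ?_
      have : (β + s).degree ≠ r * d := by rw [map_add, hdeg s hs]; exact hβ
      simp only [Φ, if_neg this, mul_zero]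
  have hkill : ∀ i x, φK (x * F i) = 0 := by
    intro i x
    induction x using MvPolynomial.induction_on' with
    | add x y hx hy => rw [add_mul, map_add, hx, hy, add_zero]
    | monomial β c =>
      have hFi : F i = ∑ s ∈ (f' i).support, monomial s (ρ ((f' i).coeff s)) := by
        simp only [F]
        conv_lhs => rw [(f' i).as_sum, map_sum]
        refine Finset.sum_congr rfl fun s _ => ?_
        rw [map_monomial]
      have h3 := congrArg ρ (hrel i β)
      rw [map_sum, map_zero] at h3
      rw [hFi, Finset.mul_sum, map_sum]
      have : ∀ s ∈ (f' i).support, φK (monomial β c * monomial s (ρ ((f' i).coeff s))) =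
          c * ρ ((f' i).coeff s * Φ' (β + s)) := by
        intro s _
        rw [monomial_mul, hφK, map_mul, mul_assoc]
      rw [Finset.sum_congr rfl this, ← Finset.mul_sum, h3, mul_zero]
  obtain ⟨c, hc⟩ := (Ideal.mem_span_range_iff_exists_fun).1 hmem
  have h4 : φK (monomial γ 1) = 0 := by
    rw [← hc, map_sum]
    exact Finset.sum_eq_zero fun i _ => hkill i _
  have h5 : Φ' γ = 1 := by
    apply hι
    rw [hΦ', map_one]
    simp only [Φ, if_pos hγ, hφ1]
  rw [hφK, h5, map_one, mul_one] at h4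
  exact one_ne_zero h4

lemma homComp_mul {d r M : ℕ} (hrM : r ≤ M) (c f : MvPolynomial (Fin d) ℂ)
    (hf : f.IsHomogeneous r) :
    homogeneousComponent M (c * f) = homogeneousComponent (M - r) c * f := by
  induction c using MvPolynomial.induction_on' with
  | monomial s a =>
    have h1 : (monomial s a).IsHomogeneous s.degree := isHomogeneous_monomial a rfl
    have h2 := h1.mul hf
    rw [homogeneousComponent_of_mem h2, homogeneousComponent_of_mem h1]
    by_cases h : M = s.degree + r
    · rw [if_pos h, if_pos (by omega)]
    · rw [if_neg h, if_neg (by omega), zero_mul]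
  | add p q hp hq => rw [add_mul, map_add, map_add, hp, hq, add_mul]

lemma nullst {d r : ℕ} (hr : 1 ≤ r) (f : Fin d → MvPolynomial (Fin d) ℂ)
    (hf : ∀ i, (f i).IsHomogeneous r)
    (h0 : ∀ x : Fin d → ℂ, (∀ i, eval x (f i) = 0) → x = 0) :
    ∃ M, r ≤ M ∧ ∃ H : Fin d → Fin d → MvPolynomial (Fin d) ℂ,
      (∀ j i, (H j i).IsHomogeneous (M - r)) ∧ ∀ j, X j ^ M = ∑ i, H j i * f i := by
  have h1 : ∀ j : Fin d, (X j : MvPolynomial (Fin d) ℂ) ∈ (Ideal.span (Set.range f)).radical := by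
    intro j
    rw [← vanishingIdeal_zeroLocus_eq_radical (k := ℂ) (K := ℂ)]
    intro x hx
    have : x = 0 := h0 x (fun i => by
      have := hx (f i) (Ideal.subset_span ⟨i, rfl⟩)
      simpa [aeval_eq_eval] using this)
    simp [this]
  choose n hn using h1
  have h2 : ∀ j, (X j : MvPolynomial (Fin d) ℂ) ^ (r + ∑ i, n i) ∈ Ideal.span (Set.range f) := by
    intro j
    refine Ideal.pow_mem_of_pow_mem _ (hn j) ?_
    have := Finset.single_le_sum (f := n) (fun i _ => Nat.zero_le _) (Finset.mem_univ j)
    omega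
  set M := r + ∑ i, n i with hM
  have hrM : r ≤ M := by omega
  have h3 : ∀ j, ∃ c : Fin d → MvPolynomial (Fin d) ℂ, ∑ i, c i * f i = X j ^ M := fun j =>
    (Ideal.mem_span_range_iff_exists_fun).1 (h2 j)
  choose c hc using h3
  refine ⟨M, hrM, fun j i => homogeneousComponent (M - r) (c j i),
    fun j i => homogeneousComponent_isHomogeneous _ _, fun j => ?_⟩
  have h4 := congrArg (homogeneousComponent M) (hc j)
  rw [map_sum, homogeneousComponent_of_mem (isHomogeneous_X_pow j M), if_pos rfl] at h4
  rw [← h4]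
  exact Finset.sum_congr rfl fun i _ => homComp_mul hrM _ _ (hf i)

lemma eval_smul_hom {n e : ℕ} (P : MvPolynomial (Fin n) ℂ) (hP : P.IsHomogeneous e) (t : ℂ)
    (x : Fin n → ℂ) : eval (fun i => t * x i) P = t ^ e * eval x P := by
  rw [eval_eq, eval_eq, Finset.mul_sum]
  refine Finset.sum_congr rfl fun s hs => ?_
  have h : ∑ i, s i = e := by
    have := hP (mem_support_iff.1 hs)
    rw [← this, Finsupp.weight_apply, Finsupp.sum_fintype _ _ (by simp)]
    simp
  have h2 : ∀ y : Fin n → ℂ, ∏ i ∈ s.support, y i ^ s i = ∏ i, y i ^ s i := fun y =>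
    Finset.prod_subset (Finset.subset_univ _) fun i _ hi => by
      simp [Finsupp.notMem_support_iff.1 hi]
  rw [h2, h2]
  simp only [mul_pow]
  rw [Finset.prod_mul_distrib, Finset.prod_pow_eq_pow_sum, h]
  ring

lemma exists_rel {d r n : ℕ} (hr : 1 ≤ r) (hn : d < n) (f : Fin n → MvPolynomial (Fin d) ℂ)
    (hf : ∀ i, (f i).IsHomogeneous r) :
    ∃ (e : ℕ) (P : MvPolynomial (Fin n) ℂ), P ≠ 0 ∧ P.IsHomogeneous e ∧ aeval f P = 0 := by
  have h1 : ¬ AlgebraicIndependent ℂ f := by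
    intro h
    have := h.lift_cardinalMk_le_trdeg
    rw [MvPolynomial.trdeg_of_isDomain] at this
    simp at this
    omega
  rw [algebraicIndependent_iff] at h1
  push Not at h1
  obtain ⟨P, hP, hP0⟩ := h1
  have h2 : ∃ e, homogeneousComponent e P ≠ 0 := by
    by_contra! h
    apply hP0
    rw [← sum_homogeneousComponent P]
    exact Finset.sum_eq_zero fun i _ => h i
  obtain ⟨e, he⟩ := h2
  refine ⟨e, homogeneousComponent e P, he, homogeneousComponent_isHomogeneous _ _, ?_⟩
  have h3 := congrArg (homogeneousComponent (r * e)) hP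
  rw [← sum_homogeneousComponent P, map_sum, map_sum, map_zero] at h3
  have h4 : ∀ i, homogeneousComponent (r * e) (aeval f (homogeneousComponent i P)) =
      if i = e then aeval f (homogeneousComponent e P) else 0 := by
    intro i
    have := (homogeneousComponent_isHomogeneous i P).aeval f hf
    rw [homogeneousComponent_of_mem this]
    by_cases h : i = e
    · simp [h]
    · rw [if_neg h, if_neg]
      intro h'
      exact h (Nat.eq_of_mul_eq_mul_left hr h').symm
  simp only [h4] at h3
  rw [Finset.sum_ite_eq' ] at h3
  split_ifs at h3 with h5
  · exact h3
  · rw [homogeneousComponent_eq_zero, map_zero]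
    simp at h5
    omega

lemma eval_aeval_aux {n d : ℕ} (f : Fin n → MvPolynomial (Fin d) ℂ) (x : Fin d → ℂ)
    (P : MvPolynomial (Fin n) ℂ) :
    eval x (aeval f P) = eval (fun i => eval x (f i)) P := by
  induction P using MvPolynomial.induction_on with
  | C a => simp
  | add p q hp hq => rw [map_add, map_add, map_add, hp, hq]
  | mul_X p i hp => rw [map_mul, map_mul, map_mul, hp, aeval_X, eval_X]

lemma reduce_one {d r k : ℕ} (hr : 1 ≤ r) (hk : d ≤ k) (W : Submodule ℂ (MvPolynomial (Fin d) ℂ))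
    (hW : ∀ p ∈ W, p.IsHomogeneous r)
    (f : Fin (k + 1) → MvPolynomial (Fin d) ℂ) (hf : ∀ i, f i ∈ W)
    (h0 : ∀ x : Fin d → ℂ, (∀ i, eval x (f i) = 0) → x = 0) :
    ∃ g : Fin k → MvPolynomial (Fin d) ℂ, (∀ i, g i ∈ W) ∧
      ∀ x : Fin d → ℂ, (∀ i, eval x (g i) = 0) → x = 0 := by
  obtain ⟨e, P, hP0, hPe, hP⟩ := exists_rel hr (Nat.lt_succ_of_le hk) f (fun i => hW _ (hf i))
  have h1 : e ≠ 0 := by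
    rintro rfl
    have h := (totalDegree_zero_iff_isHomogeneous _).2 hPe
    rw [totalDegree_eq_zero_iff_eq_C] at h
    rw [h] at hP hP0
    simp at hP
    rw [hP] at hP0
    simp at hP0
  have h2 : ∃ c : Fin (k+1) → ℂ, eval c P ≠ 0 := by
    by_contra! h
    exact hP0 (hPe.eq_zero_of_forall_eval_eq_zero h)
  obtain ⟨c, hc⟩ := h2
  have h3 : ∃ j, c j ≠ 0 := by
    by_contra! h
    apply hc
    have := eval_smul_hom P hPe 0 c
    rw [zero_pow h1, zero_mul] at this
    rw [← this]
    congr 2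
    ext i
    simp [h i]
  obtain ⟨j, hj⟩ := h3
  refine ⟨fun i => c j • f (j.succAbove i) - c (j.succAbove i) • f j,
    fun i => W.sub_mem (W.smul_mem _ (hf _)) (W.smul_mem _ (hf _)), fun x hx => ?_⟩
  have h4 : ∀ i, c j * eval x (f i) = eval x (f j) * c i := by
    intro i
    rcases Fin.eq_self_or_eq_succAbove j i with rfl | ⟨i, rfl⟩
    · ring
    · have := hx i
      simp [smul_eval] at this
      linear_combination this
  have h5 : eval (fun i => eval x (f i)) P = 0 := by
    have := congrArg (eval x) hP
    rw [map_zero] at this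
    rw [← this, eval_aeval_aux]
  have h6 := eval_smul_hom P hPe (c j) (fun i => eval x (f i))
  simp only [h4] at h6
  rw [eval_smul_hom P hPe, h5, mul_zero] at h6
  have h7 : eval x (f j) = 0 := by
    rcases mul_eq_zero.1 h6 with h | h
    · exact pow_eq_zero_iff h1 |>.1 h
    · exact absurd h hc
  apply h0
  intro i
  have := h4 i
  rw [h7, zero_mul] at this
  exact (mul_eq_zero.1 this).resolve_left hj

lemma choose_forms {d r : ℕ} (hr : 1 ≤ r) (W : Submodule ℂ (MvPolynomial (Fin d) ℂ))
    (hW : ∀ p ∈ W, p.IsHomogeneous r)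
    (h0 : ∀ x : Fin d → ℂ, (∀ p ∈ W, eval x p = 0) → x = 0) :
    ∃ g : Fin d → MvPolynomial (Fin d) ℂ, (∀ i, g i ∈ W) ∧
      ∀ x : Fin d → ℂ, (∀ i, eval x (g i) = 0) → x = 0 := by
  have hle : W ≤ homogeneousSubmodule (Fin d) ℂ r := fun p hp => hW p hp
  have : Module.Finite ℂ (homogeneousSubmodule (Fin d) ℂ r) :=
    Module.Finite.iff_fg.2 (homogeneousSubmodule_fg _ _ _)
  have hfg : Module.Finite ℂ W := Submodule.finiteDimensional_of_le hle
  obtain ⟨n, s, hs⟩ := Submodule.fg_iff_exists_fin_generating_family.1 (Module.Finite.iff_fg.1 hfg)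
  have key : ∀ n (f : Fin n → MvPolynomial (Fin d) ℂ), (∀ i, f i ∈ W) →
      (∀ x : Fin d → ℂ, (∀ i, eval x (f i) = 0) → x = 0) → 
      ∃ g : Fin d → MvPolynomial (Fin d) ℂ, (∀ i, g i ∈ W) ∧
        ∀ x : Fin d → ℂ, (∀ i, eval x (g i) = 0) → x = 0 := by
    intro n
    induction n with
    | zero =>
      intro f _ h
      exact ⟨fun _ => 0, fun _ => W.zero_mem, fun x _ => h x (fun i => i.elim0)⟩
    | succ k ih =>
      intro f hf h
      by_cases hk : d ≤ k
      · obtain ⟨g, hg, hg0⟩ := reduce_one hr hk W hW f hf h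
        exact ih g hg hg0
      · refine ⟨fun i => if hi : i.1 < k + 1 then f ⟨i, hi⟩ else 0, fun i => ?_, fun x hx => ?_⟩
        · dsimp only
          split_ifs
          · exact hf _
          · exact W.zero_mem
        · apply h
          intro i
          have := hx ⟨i.1, by omega⟩
          dsimp only at this
          rw [dif_pos i.2] at this
          exact this
  refine key n s (fun i => hs ▸ Submodule.subset_span ⟨i, rfl⟩) fun x hx => h0 x ?_
  intro p hp
  rw [← hs] at hp
  induction hp using Submodule.span_induction with
  | mem y hy => obtain ⟨i, rfl⟩ := hy; exact hx i
  | zero => simp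
  | add y z _ _ h1 h2 => rw [map_add, h1, h2, add_zero]
  | smul a y _ h => rw [smul_eval, h, mul_zero]

lemma homComp_mem_span {d r N : ℕ} (hrd : r ≤ N) (A : Set (MvPolynomial (Fin d) ℂ))
    (hA : ∀ a ∈ A, a.IsHomogeneous r) (p : MvPolynomial (Fin d) ℂ) (hp : p ∈ Ideal.span A) :
    homogeneousComponent N p ∈
      Submodule.span ℂ {q | ∃ a ∈ A, ∃ g : MvPolynomial (Fin d) ℂ,
      g.IsHomogeneous (N - r) ∧ q = a * g} := by
  obtain ⟨n, c, g, rfl⟩ := Submodule.mem_span_set'.1 hp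
  rw [map_sum]
  refine Submodule.sum_mem _ fun i _ => ?_
  rw [smul_eq_mul, homComp_mul hrd _ _ (hA _ (g i).2), mul_comm]
  exact Submodule.subset_span ⟨g i, (g i).2, _, homogeneousComponent_isHomogeneous _ _, rfl⟩

lemma macaulay_span {d r : ℕ} (hd : 1 ≤ d) (hr : 1 ≤ r) (A : Set (MvPolynomial (Fin d) ℂ))
    (hA : ∀ a ∈ A, a.IsHomogeneous r)
    (hAzero : ∀ x : Fin d → ℂ, (∀ a ∈ A, eval x a = 0) → x = 0)
    (p : MvPolynomial (Fin d) ℂ) (hp : p.IsHomogeneous (r * d)) :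
    p ∈ Submodule.span ℂ {q | ∃ a ∈ A, ∃ g : MvPolynomial (Fin d) ℂ,
      g.IsHomogeneous (r * d - r) ∧ q = a * g} := by
  have hrd : r ≤ r * d := Nat.le_mul_of_pos_right r hd
  obtain ⟨f, hfA, hf0⟩ := choose_forms hr (Submodule.span ℂ A)
    (fun p hp => (Submodule.span_le (p := homogeneousSubmodule (Fin d) ℂ r)).2
      (fun a ha => hA a ha) hp)
    (fun x hx => hAzero x fun a ha => hx a (Submodule.subset_span ha))
  have hf : ∀ i, (f i).IsHomogeneous r := fun i =>
    (Submodule.span_le (p := homogeneousSubmodule (Fin d) ℂ r)).2 (fun a ha => hA a ha) (hfA i)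
  obtain ⟨M, hrM, H, hH, hX⟩ := nullst hr f hf hf0
  have h1 : p ∈ Ideal.span (Set.range f) := by
    rw [p.as_sum]
    refine Ideal.sum_mem _ fun γ hγ => ?_
    have hdeg : γ.degree = r * d := by
      rw [Finsupp.degree_eq_weight_one]
      exact hp (mem_support_iff.1 hγ)
    have := complex_macaulay hd hrM f hf H hH hX γ hdeg
    have h2 := Ideal.mul_mem_left _ (C (coeff γ p)) this
    rwa [C_mul_monomial, mul_one] at h2
  have h2 : p ∈ Ideal.span A := by
    refine (Ideal.span_le.2 ?_) h1
    rintro _ ⟨i, rfl⟩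
    have : Submodule.span ℂ A ≤ (Ideal.span A).restrictScalars ℂ :=
      Submodule.span_le.2 fun a ha => Ideal.subset_span ha
    exact this (hfA i)
  have h4 := homComp_mem_span hrd A hA p h2
  rwa [homogeneousComponent_of_mem hp, if_pos rfl] at h4

lemma prod_lift {d N : ℕ} (A B : Set (MvPolynomial (Fin d) ℂ))
    (l : List (Module.End ℂ (homogeneousSubmodule (Fin d) ℂ N)))
    (hl : ∀ g ∈ l, ∃ a ∈ A, ∃ b ∈ B, ∀ p : homogeneousSubmodule (Fin d) ℂ N,
      (g p : MvPolynomial (Fin d) ℂ) = (LinearMap.mulLeft ℂ a * diffOp d b) p) :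
    ∃ a b : Fin l.length → MvPolynomial (Fin d) ℂ,
        (∀ i, a i ∈ A) ∧ (∀ i, b i ∈ B) ∧ ∀ p : homogeneousSubmodule (Fin d) ℂ N,
          (l.prod p : MvPolynomial (Fin d) ℂ) = (List.ofFn fun i : Fin l.length =>
              LinearMap.mulLeft ℂ (a i) * diffOp d (b i)).prod p := by
  induction l with
  | nil => exact ⟨fun i => i.elim0, fun i => i.elim0, fun i => i.elim0, fun i => i.elim0,
      fun p => by simp⟩
  | cons g l ih =>
    obtain ⟨a, b, ha, hb, h⟩ := ih fun g hg => hl g (List.mem_cons_of_mem _ hg)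
    obtain ⟨a0, ha0, b0, hb0, h0⟩ := hl g List.mem_cons_self
    refine ⟨Fin.cons (α := fun _ => MvPolynomial (Fin d) ℂ) a0 a,
      Fin.cons (α := fun _ => MvPolynomial (Fin d) ℂ) b0 b, ?_, ?_, ?_⟩
    · intro i
      refine Fin.cases ?_ (fun i => ?_) i
      · exact ha0
      · exact ha i
    · intro i
      refine Fin.cases ?_ (fun i => ?_) i
      · exact hb0
      · exact hb i
    · intro p
      have e : (List.ofFn fun i : Fin (g :: l).length =>
          LinearMap.mulLeft ℂ ((Fin.cons a0 a : Fin (l.length + 1) → MvPolynomial (Fin d) ℂ) i) *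
            diffOp d ((Fin.cons b0 b : Fin (l.length + 1) → MvPolynomial (Fin d) ℂ) i)) =
          (LinearMap.mulLeft ℂ a0 * diffOp d b0) :: List.ofFn fun i : Fin l.length =>
              LinearMap.mulLeft ℂ (a i) * diffOp d (b i) := by
        exact List.ofFn_succ
      rw [e, List.prod_cons, List.prod_cons, Module.End.mul_apply g, h0, h p]
      rfl

lemma opPres {d r : ℕ} (hrd : r ≤ r * d) {a b : MvPolynomial (Fin d) ℂ} (ha : a.IsHomogeneous r)
    (hb : b.IsHomogeneous r) : ∀ p ∈ homogeneousSubmodule (Fin d) ℂ (r * d),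
      (LinearMap.mulLeft ℂ a * diffOp d b) p ∈ homogeneousSubmodule (Fin d) ℂ (r * d) := by
  intro p hp
  have := ha.mul (hom_diffOp hb hp)
  rw [Nat.add_sub_cancel' hrd] at this
  exact this

theorem exists_short_product_trace_ne_zero (d r : ℕ) (hd : 1 ≤ d) (hr : 1 ≤ r)
    (A B : Set (MvPolynomial (Fin d) ℂ))
    (hA : ∀ a ∈ A, a.IsHomogeneous r) (hB : ∀ b ∈ B, b.IsHomogeneous r)
    (hAzero : ∀ x : Fin d → ℂ, (∀ a ∈ A, MvPolynomial.eval x a = 0) → x = 0)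
    (hBzero : ∀ x : Fin d → ℂ, (∀ b ∈ B, MvPolynomial.eval x b = 0) → x = 0) :
    ∃ m : ℕ, 1 ≤ m ∧
      m ≤ (Module.finrank ℂ (homogeneousSubmodule (Fin d) ℂ (r * d))) ^ 2 ∧
      ∃ a b : Fin m → MvPolynomial (Fin d) ℂ,
        (∀ i, a i ∈ A) ∧ (∀ i, b i ∈ B) ∧
        ∃ h : ∀ p ∈ homogeneousSubmodule (Fin d) ℂ (r * d),
            (List.ofFn fun i : Fin m =>
              LinearMap.mulLeft ℂ (a i) * diffOp d (b i)).prod p ∈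
              homogeneousSubmodule (Fin d) ℂ (r * d),
          LinearMap.trace ℂ (homogeneousSubmodule (Fin d) ℂ (r * d))
            ((List.ofFn fun i : Fin m =>
              LinearMap.mulLeft ℂ (a i) * diffOp d (b i)).prod.restrict h) ≠ 0 := by
  have hrd : r ≤ r * d := Nat.le_mul_of_pos_right r hd
  have hfin : FiniteDimensional ℂ (homogeneousSubmodule (Fin d) ℂ (r * d)) :=
    Module.Finite.iff_fg.2 (homogeneousSubmodule_fg _ _ _)
  have hnt : Nontrivial (homogeneousSubmodule (Fin d) ℂ (r * d)) := by
    refine ⟨⟨X ⟨0, hd⟩ ^ (r * d), isHomogeneous_X_pow _ _⟩, 0, fun h => ?_⟩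
    have := congrArg Subtype.val h
    exact pow_ne_zero _ (X_ne_zero _) this
  have hb : ∃ b ∈ B, b ≠ 0 := by
    by_contra! h
    have := hBzero (fun _ => 1) (fun b hb => by rw [h b hb, map_zero])
    exact one_ne_zero (congrFun this ⟨0, hd⟩)
  obtain ⟨b0, hb0, hb0'⟩ := hb
  let G : Set (Module.End ℂ (homogeneousSubmodule (Fin d) ℂ (r * d))) :=
    {g | ∃ a ∈ A, ∃ b ∈ B, ∀ p : homogeneousSubmodule (Fin d) ℂ (r * d),
      (g p : MvPolynomial (Fin d) ℂ) = (LinearMap.mulLeft ℂ a * diffOp d b) p}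
  have hG : Submodule.span ℂ {x | ∃ g ∈ G, ∃ v, g v = x} = ⊤ := by
    rw [eq_top_iff]
    rintro ⟨p, hp⟩ -
    have h1 := macaulay_span hd hr A hA hAzero p hp
    have h2 : Submodule.span ℂ {q | ∃ a ∈ A, ∃ g : MvPolynomial (Fin d) ℂ,
        g.IsHomogeneous (r * d - r) ∧ q = a * g} ≤
        (Submodule.span ℂ {x | ∃ g ∈ G, ∃ v, g v = x}).map
          (homogeneousSubmodule (Fin d) ℂ (r * d)).subtype := by
      rw [Submodule.span_le]
      rintro q ⟨a, ha, g, hg, rfl⟩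
      obtain ⟨v, hv, hvg⟩ := diffOp_surj (hB b0 hb0) hb0' g hg
      rw [Nat.sub_add_cancel hrd] at hv
      refine ⟨(LinearMap.mulLeft ℂ a * diffOp d b0).restrict (opPres hrd (hA a ha) (hB b0 hb0))
        ⟨v, hv⟩, Submodule.subset_span ⟨_, ⟨a, ha, b0, hb0, fun p => rfl⟩, _, rfl⟩, ?_⟩
      rw [← hvg]
      rfl
    obtain ⟨y, hy, hyp⟩ := h2 h1
    have : y = ⟨p, hp⟩ := Subtype.ext hyp
    rwa [← this]
  obtain ⟨l, hl, hl1, hl2, htr⟩ := exists_word_trace G hG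
  obtain ⟨a, b, ha, hb, h⟩ := prod_lift A B l hl
  refine ⟨l.length, hl1, hl2, a, b, ha, hb, fun p hp => ?_, ?_⟩
  · rw [← h ⟨p, hp⟩]
    exact (l.prod ⟨p, hp⟩).2
  · convert htr using 2
    ext1 p
    exact Subtype.ext (h p).symm
end

section
/- Let d ≥ 1 and r ≥ 1 be natural numbers and let A and B be sets of homogeneous polynomials of degree r in ℂ[X_1,…,X_d], each of which has the origin as its only common zero in ℂ^d. Then for every N ≥ rd there exist m ≥ 1 and elements a_1,…,a_m ∈ A, b_1,…,b_m ∈ B such that the operator M_{a_1} ∘ b_1(∂) ∘ ⋯ ∘ M_{a_m} ∘ b_m(∂), restricted to the space S_N of homogeneous polynomials of degree N (which it maps into itself), is not nilpotent. -/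
open MvPolynomial

lemma aux_pow_mem {V : Type*} [AddCommGroup V] [Module ℂ V]
    (W : Submodule ℂ (Module.End ℂ V)) (hmul : ∀ x ∈ W, ∀ y ∈ W, x * y ∈ W)
    (w : Module.End ℂ V) (hw : w ∈ W) (q : Polynomial ℂ) :
    Polynomial.aeval w (q * Polynomial.X) ∈ W := by
  induction q using Polynomial.induction_on' with
  | add p q hp hq => rw [add_mul, map_add]; exact W.add_mem hp hq
  | monomial n a =>
    have h : ∀ n : ℕ, w ^ n * w ∈ W := by
      intro n
      induction n with
      | zero => simpa using hw
      | succ n ih => rw [pow_succ]; exact hmul _ ih _ hw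
    rw [map_mul, Polynomial.aeval_monomial, Polynomial.aeval_X, mul_assoc, ← Algebra.smul_def]
    exact W.smul_mem _ (h n)

lemma aux_nil {V : Type*} [AddCommGroup V] [Module ℂ V] [FiniteDimensional ℂ V]
    (W : Submodule ℂ (Module.End ℂ V)) (hmul : ∀ x ∈ W, ∀ y ∈ W, x * y ∈ W)
    (htr : ∀ x ∈ W, LinearMap.trace ℂ V x = 0)
    (w : Module.End ℂ V) (hw : w ∈ W) : IsNilpotent w := by
  have hint : IsIntegral ℂ w := Algebra.IsIntegral.isIntegral w
  have hne : minpoly ℂ w ≠ 0 := minpoly.ne_zero hint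
  obtain ⟨h, hh, hnd⟩ := Polynomial.exists_eq_pow_rootMultiplicity_mul_and_not_dvd
    (minpoly ℂ w) hne 0
  set k := (minpoly ℂ w).rootMultiplicity 0
  simp only [Polynomial.C_0, sub_zero] at hh hnd
  have hcop : IsCoprime (Polynomial.X ^ (k+1) : Polynomial ℂ) h := by
    apply IsCoprime.pow_left
    exact (Polynomial.irreducible_X.coprime_iff_not_dvd).2 hnd
  obtain ⟨u, v, huv⟩ := hcop
  have h0 : Polynomial.aeval w (Polynomial.X ^ k * h) = 0 := by
    rw [← hh]; exact minpoly.aeval _ _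
  set e := Polynomial.aeval w ((u * Polynomial.X ^ k) * Polynomial.X) with he
  have heW : e ∈ W := aux_pow_mem W hmul w hw _
  have h1 : Polynomial.aeval w (v * h) = 1 - e := by
    rw [he, eq_sub_iff_add_eq, ← map_add]
    rw [show v * h + u * Polynomial.X ^ k * Polynomial.X = 1 by rw [← huv]; ring, map_one]
  have hid : e * (1 - e) = 0 := by
    rw [← h1, he, ← map_mul,
      show u * Polynomial.X ^ k * Polynomial.X * (v * h)
        = (u * v * Polynomial.X) * (Polynomial.X ^ k * h) by ring, map_mul, h0, mul_zero]
  have hie : IsIdempotentElem e := by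
    rw [mul_sub, mul_one, sub_eq_zero] at hid
    exact hid.symm
  have hez : e = 0 := (LinearMap.IsIdempotentElem.trace_eq_zero_iff (R := ℂ) (M := V) (e := e) hie).1 (htr e heW)
  rw [hez, sub_zero] at h1
  refine ⟨k, ?_⟩
  have : Polynomial.aeval w (Polynomial.X ^ k : Polynomial ℂ) * Polynomial.aeval w (v * h) = 0 := by
    rw [← map_mul, show (Polynomial.X ^ k * (v * h) : Polynomial ℂ)
      = v * (Polynomial.X ^ k * h) by ring, map_mul, h0, mul_zero]
  rw [h1, mul_one] at this
  simpa using this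

attribute [local instance] LieRing.ofAssociativeRing in
lemma aux_common_kernel {V : Type*} [AddCommGroup V] [Module ℂ V] [FiniteDimensional ℂ V]
    [Nontrivial V]
    (P : Set (Module.End ℂ V)) (hmul : ∀ x ∈ P, ∀ y ∈ P, x * y ∈ P)
    (hnil : ∀ x ∈ P, IsNilpotent x) : ∃ v : V, v ≠ 0 ∧ ∀ x ∈ P, x v = 0 := by
  set W := Submodule.span ℂ P with hW
  have hWm : ∀ x ∈ W, ∀ y ∈ W, x * y ∈ W := by
    intro x hx y hy
    have := Submodule.mul_mem_mul hx hy
    rw [hW, Submodule.span_mul_span] at this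
    refine Submodule.span_mono ?_ this
    rintro _ ⟨a, ha, b, hb, rfl⟩
    exact hmul a ha b hb
  have htr : ∀ x ∈ W, LinearMap.trace ℂ V x = 0 := by
    intro x hx
    have : W ≤ LinearMap.ker (LinearMap.trace ℂ V) := by
      rw [hW, Submodule.span_le]
      intro p hp
      exact (LinearMap.isNilpotent_trace_of_isNilpotent (hnil p hp)).eq_zero
    exact this hx
  have hWn := aux_nil W hWm htr
  let L : LieSubalgebra ℂ (Module.End ℂ V) :=
    { W with
      lie_mem' := by
        intro x y hx hy
        exact W.sub_mem (hWm _ hx _ hy) (hWm _ hy _ hx) }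
  have hN : LieModule.IsNilpotent L V := by
    rw [LieModule.isNilpotent_iff_forall (R := ℂ)]
    rintro ⟨x, hx⟩
    exact hWn x hx
  have := LieModule.nontrivial_max_triv_of_isNilpotent ℂ L V
  obtain ⟨⟨v, hv⟩, hv0⟩ := exists_ne (0 : LieModule.maxTrivSubmodule ℂ L V)
  refine ⟨v, fun h => hv0 (Subtype.ext h), fun x hx => ?_⟩
  rw [LieModule.mem_maxTrivSubmodule] at hv
  exact hv ⟨x, Submodule.subset_span hx⟩

lemma aux_comp_X_mul {d : ℕ} (k : Fin d) (n : ℕ) (q : MvPolynomial (Fin d) ℂ) :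
    homogeneousComponent (n+1) (X k * q) = X k * homogeneousComponent n q := by
  ext m
  rw [coeff_homogeneousComponent, coeff_X_mul', coeff_X_mul', coeff_homogeneousComponent]
  by_cases hk : k ∈ m.support
  · have : (m - Finsupp.single k 1).degree + 1 = m.degree := by
      have h1 : m = (m - Finsupp.single k 1) + Finsupp.single k 1 := by
        rw [tsub_add_cancel_of_le]
        rw [Finsupp.single_le_iff]
        exact Nat.one_le_iff_ne_zero.2 (Finsupp.mem_support_iff.1 hk)
      conv_rhs => rw [h1, map_add, Finsupp.degree_single]
    simp only [if_pos hk]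
    congr 1
    rw [← this]; simp
  · simp [hk]

lemma aux_avoid {d : ℕ} {B : Set (MvPolynomial (Fin d) ℂ)}
    (hBzero : ∀ x : Fin d → ℂ, (∀ b ∈ B, MvPolynomial.eval x b = 0) → x = 0)
    (k : Fin d) {ι : Type} [Finite ι] (J : ι → Ideal (MvPolynomial (Fin d) ℂ))
    (hJ : ∀ i p, X k * p ∈ J i → p ∈ J i) :
    ∃ f ∈ Submodule.span ℂ B, ∀ i p, f * p ∈ J i → p ∈ J i := by
  have hrad : (X k : MvPolynomial (Fin d) ℂ) ∈ (Ideal.span B).radical := by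
    rw [← vanishingIdeal_zeroLocus_eq_radical (K := ℂ), mem_vanishingIdeal_iff]
    intro x hx
    rw [mem_zeroLocus_iff] at hx
    have : x = 0 := hBzero x fun b hb => by
      simpa using hx b (Ideal.subset_span hb)
    simp [this]
  let Q := Σ i, associatedPrimes (MvPolynomial (Fin d) ℂ) (MvPolynomial (Fin d) ℂ ⧸ J i)
  have hfin : ∀ i, Finite (associatedPrimes (MvPolynomial (Fin d) ℂ)
      (MvPolynomial (Fin d) ℂ ⧸ J i)) := fun i => (associatedPrimes.finite _ _).to_subtype
  have : Finite Q := inferInstance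
  have key : ∀ i (f : MvPolynomial (Fin d) ℂ), (∀ p, f * p ∈ J i → p ∈ J i) ↔
      ∀ P ∈ associatedPrimes (MvPolynomial (Fin d) ℂ) (MvPolynomial (Fin d) ℂ ⧸ J i), f ∉ P := by
    intro i f
    have h := biUnion_associatedPrimes_eq_zero_divisors (MvPolynomial (Fin d) ℂ)
      (MvPolynomial (Fin d) ℂ ⧸ J i)
    have h2 := Set.ext_iff.1 h f
    simp only [Set.mem_iUnion, SetLike.mem_coe, exists_prop, Set.mem_ofPred_eq] at h2
    have h3 : (∃ x : MvPolynomial (Fin d) ℂ ⧸ J i, x ≠ 0 ∧ f • x = 0) ↔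
        ∃ p, f * p ∈ J i ∧ p ∉ J i := by
      constructor
      · rintro ⟨x, hx0, hx⟩
        obtain ⟨p, rfl⟩ := Ideal.Quotient.mk_surjective x
        refine ⟨p, ?_, ?_⟩
        · rw [← Ideal.Quotient.eq_zero_iff_mem, ← hx]; rfl
        · rwa [← Ideal.Quotient.eq_zero_iff_mem]
      · rintro ⟨p, h1, h2⟩
        refine ⟨Ideal.Quotient.mk _ p, ?_, ?_⟩
        · rwa [Ne, Ideal.Quotient.eq_zero_iff_mem]
        · rw [← Ideal.Quotient.eq_zero_iff_mem] at h1
          rw [← h1]; rfl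
    rw [h3] at h2
    constructor
    · intro hf P hP hfP
      obtain ⟨p, h4, h5⟩ := h2.1 ⟨P, hP, hfP⟩
      exact h5 (hf p h4)
    · intro hf p hp
      by_contra hc
      obtain ⟨P, hP, hfP⟩ := h2.2 ⟨p, hp, hc⟩
      exact hf P hP hfP
  by_contra hcon
  push Not at hcon
  let U := Submodule.span ℂ B
  let S : Q → Submodule ℂ U := fun q =>
    (Submodule.restrictScalars ℂ (q.2 : Ideal (MvPolynomial (Fin d) ℂ))).comap U.subtype
  have hcov : ⋃ q, (S q : Set U) = Set.univ := by
    rw [Set.eq_univ_iff_forall]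
    rintro ⟨f, hf⟩
    obtain ⟨i, p, h1, h2⟩ := hcon f hf
    have h3 : ¬ ∀ P ∈ associatedPrimes (MvPolynomial (Fin d) ℂ)
        (MvPolynomial (Fin d) ℂ ⧸ J i), f ∉ P := by
      rw [← key i f]
      intro h; exact h2 (h p h1)
    push Not at h3
    obtain ⟨P, hP, hfP⟩ := h3
    rw [Set.mem_iUnion]
    exact ⟨⟨i, P, hP⟩, hfP⟩
  obtain ⟨⟨i, P, hP⟩, htop⟩ := Subspace.exists_eq_top_of_iUnion_eq_univ hcov
  have hBP : Ideal.span B ≤ P := by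
    rw [Ideal.span_le]
    intro b hb
    have : (⟨b, Submodule.subset_span hb⟩ : U) ∈ S ⟨i, P, hP⟩ := by rw [htop]; trivial
    exact this
  have hPp : P.IsPrime := hP.1
  have hX : X k ∈ P := hPp.radical_le_iff.2 hBP hrad
  exact (key i (X k)).1 (hJ i) P hP hX

attribute [local instance] MvPolynomial.gradedAlgebra in
lemma aux_degree {d r : ℕ} (k : Fin d) (J : Ideal (MvPolynomial (Fin d) ℂ))
    (hJh : J.IsHomogeneous (homogeneousSubmodule (Fin d) ℂ))
    (f : MvPolynomial (Fin d) ℂ) (hf : f.IsHomogeneous r)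
    (hreg : ∀ p, f * p ∈ J → p ∈ J) (K : ℕ)
    (hK : ∀ s, K ≤ s → ∀ p : MvPolynomial (Fin d) ℂ, p.IsHomogeneous s →
      p ∈ Ideal.span {X k} ⊔ J)
    (t : ℕ) (ht : K ≤ t + 1) (p : MvPolynomial (Fin d) ℂ) (hp : p.IsHomogeneous (t + r)) :
    p ∈ Ideal.span {f} ⊔ J := by
  let π : MvPolynomial (Fin d) ℂ →ₗ[ℂ] (MvPolynomial (Fin d) ℂ ⧸ J) :=
    (Ideal.Quotient.mkₐ ℂ J).toLinearMap
  have hπ : ∀ p, π p = 0 ↔ p ∈ J := fun p => Ideal.Quotient.eq_zero_iff_mem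
  have hπm : ∀ p q, π (p * q) = π p * π q := fun p q => map_mul (Ideal.Quotient.mkₐ ℂ J) p q
  let V : ℕ → Submodule ℂ (MvPolynomial (Fin d) ℂ ⧸ J) := fun s =>
    (homogeneousSubmodule (Fin d) ℂ s).map π
  have hfd : ∀ s, FiniteDimensional ℂ (V s) := fun s => by
    have : FiniteDimensional ℂ (homogeneousSubmodule (Fin d) ℂ s) :=
      Module.Finite.iff_fg.2 (homogeneousSubmodule_fg _ _ s)
    infer_instance
  have h1 : ∀ s, K ≤ s + 1 → V (s+1) ≤ (V s).map (LinearMap.mulLeft ℂ (π (X k))) := by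
    rintro s hs _ ⟨q, hq, rfl⟩
    have hq' : q.IsHomogeneous (s+1) := hq
    have h := hK (s+1) hs q hq
    rw [Ideal.mem_span_singleton_sup] at h
    obtain ⟨a, j, hj, hajq⟩ := h
    refine ⟨π (homogeneousComponent s a), ⟨_, homogeneousComponent_mem s a, rfl⟩, ?_⟩
    have h2 : q = X k * homogeneousComponent s a + homogeneousComponent (s+1) j := by
      rw [← aux_comp_X_mul, ← map_add, mul_comm, hajq, homogeneousComponent_eq_self hq']
    rw [h2, map_add, (hπ _).2 (homogeneousComponent_mem_of_mem hJh hj _), add_zero, hπm]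
    rfl
  have h2 : ∀ m, Module.finrank ℂ (V (t+m)) ≤ Module.finrank ℂ (V t) := by
    intro m
    induction m with
    | zero => exact le_rfl
    | succ m ih =>
      refine le_trans ?_ ih
      exact (Submodule.finrank_mono (h1 (t+m) (by omega))).trans (Submodule.finrank_map_le _ _)
  have hinj : Function.Injective (LinearMap.mulLeft ℂ (π f)) := by
    rw [← LinearMap.ker_eq_bot, LinearMap.ker_eq_bot']
    intro x hx
    obtain ⟨q, rfl⟩ : ∃ q, π q = x := Ideal.Quotient.mk_surjective x
    rw [hπ]
    apply hreg
    rw [← hπ, hπm]; exact hx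
  have h3 : (V t).map (LinearMap.mulLeft ℂ (π f)) ≤ V (t+r) := by
    rintro _ ⟨_, ⟨q, hq, rfl⟩, rfl⟩
    refine ⟨f * q, ?_, hπm _ _⟩
    have : (f * q).IsHomogeneous (r + t) := hf.mul hq
    rw [add_comm] at this; exact this
  have h4 : (V t).map (LinearMap.mulLeft ℂ (π f)) = V (t+r) := by
    apply Submodule.eq_of_le_of_finrank_le h3
    rw [← (Submodule.equivMapOfInjective _ hinj (V t)).finrank_eq]
    · exact h2 r
  have h5 : π p ∈ V (t+r) := ⟨p, hp, rfl⟩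
  rw [← h4] at h5
  obtain ⟨_, ⟨q, hq, rfl⟩, h6⟩ := h5
  rw [Ideal.mem_span_singleton_sup]
  refine ⟨q, p - q * f, ?_, by ring⟩
  rw [← hπ, map_sub, mul_comm, hπm, ← h6]
  exact sub_self _

attribute [local instance] MvPolynomial.gradedAlgebra in
lemma aux_ideal {d r : ℕ} (hr : 1 ≤ r) {B : Set (MvPolynomial (Fin d) ℂ)}
    (hB : ∀ b ∈ B, b.IsHomogeneous r)
    (hBzero : ∀ x : Fin d → ℂ, (∀ b ∈ B, MvPolynomial.eval x b = 0) → x = 0)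
    (F : Finset (Fin d)) :
    ∃ y : Fin d → MvPolynomial (Fin d) ℂ,
      (∀ i ∈ F, y i ∈ Submodule.span ℂ B) ∧ (∀ i ∉ F, y i = X i) ∧
      (∀ (S : Set (Fin d)) (i : Fin d), i ∉ S → ∀ p, y i * p ∈ Ideal.span (y '' S) →
        p ∈ Ideal.span (y '' S)) ∧
      ∀ s, F.card * (r - 1) + 1 ≤ s → ∀ p : MvPolynomial (Fin d) ℂ, p.IsHomogeneous s →
        p ∈ Ideal.span (Set.range y) := by
  have hU : ∀ f ∈ Submodule.span ℂ B, f.IsHomogeneous r := by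
    intro f hf
    have : Submodule.span ℂ B ≤ homogeneousSubmodule (Fin d) ℂ r := Submodule.span_le.2 hB
    exact this hf
  classical
  induction F using Finset.induction_on with
  | empty =>
    refine ⟨X, by simp, by simp, ?_, ?_⟩
    · intro S i hi p hp
      rw [mem_ideal_span_X_image] at hp ⊢
      intro m hm
      obtain ⟨j, hj, hj0⟩ := hp (Finsupp.single i 1 + m) (by
        rw [mem_support_iff, coeff_X_mul]; exact mem_support_iff.1 hm)
      refine ⟨j, hj, ?_⟩
      have : i ≠ j := fun h => hi (h ▸ hj)
      simpa [Finsupp.single_apply, this] using hj0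
    · intro s hs p hp
      rw [← Set.image_univ, mem_ideal_span_X_image]
      intro m hm
      have h1 := hp.degree_eq_sum_deg_support hm
      by_contra hcon
      push Not at hcon
      have : m = 0 := by ext i; exact hcon i trivial
      subst this
      simp at h1
      omega
  | insert k F hk ih =>
    obtain ⟨y, hyF, hyX, hG, hdeg⟩ := ih
    obtain ⟨f, hfU, hf⟩ := aux_avoid hBzero k
      (fun S : {S : Set (Fin d) // k ∉ S} => Ideal.span (y '' S.1))
      (fun S p hp => hG S.1 k S.2 p (by rwa [hyX k hk]))
    have hf' : ∀ S : Set (Fin d), k ∉ S → ∀ p, f * p ∈ Ideal.span (y '' S) →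
      p ∈ Ideal.span (y '' S) := fun S hS => hf ⟨S, hS⟩
    have himg : ∀ S : Set (Fin d), k ∉ S → Function.update y k f '' S = y '' S := by
      intro S hS
      apply Set.image_congr
      intro a ha
      exact Function.update_of_ne (fun h : a = k => hS (h ▸ ha)) _ _
    refine ⟨Function.update y k f, ?_, ?_, ?_, ?_⟩
    · intro i hi
      by_cases h : i = k
      · subst h; simpa using hfU
      · rw [Function.update_of_ne h]; exact hyF i (by simpa [h] using hi)
    · intro i hi
      rw [Finset.mem_insert, not_or] at hi
      rw [Function.update_of_ne hi.1]; exact hyX i hi.2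
    · intro S i hi p hp
      by_cases hkS : k ∈ S
      · have hik : i ≠ k := fun h => hi (h ▸ hkS)
        obtain ⟨T, hkT, rfl⟩ : ∃ T : Set (Fin d), k ∉ T ∧ S = insert k T :=
          ⟨S \ {k}, by simp, by simp [Set.insert_eq_of_mem hkS]⟩
        have hiT : i ∉ T := fun h => hi (Set.mem_insert_of_mem _ h)
        rw [Set.image_insert_eq, himg T hkT, Function.update_self, Ideal.mem_span_insert] at hp ⊢
        rw [Function.update_of_ne hik] at hp
        obtain ⟨a, z, hz, haz⟩ := hp
        have h1 : f * a ∈ Ideal.span (y '' insert i T) := by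
          rw [Set.image_insert_eq, Ideal.mem_span_insert]
          exact ⟨p, -z, neg_mem hz, by linear_combination -haz⟩
        have h2 := hf' (insert i T) (by simp [hkT, hik.symm]) a h1
        rw [Set.image_insert_eq, Ideal.mem_span_insert] at h2
        obtain ⟨c, w, hw, hcw⟩ := h2
        refine ⟨c, p - c * f, hG T i hiT _ ?_, by ring⟩
        have : y i * (p - c * f) = f * w + z := by
          rw [mul_sub, haz, hcw]; ring
        rw [this]
        exact add_mem (Ideal.mul_mem_left _ _ hw) hz
      · rw [himg S hkS] at hp ⊢
        by_cases hik : i = k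
        · subst hik
          rw [Function.update_self] at hp
          exact hf' S hkS p hp
        · rw [Function.update_of_ne hik] at hp
          exact hG S i hi p hp
    · intro s hs p hp
      rw [Finset.card_insert_of_notMem hk, add_mul, one_mul] at hs
      have hkc : k ∉ ({k}ᶜ : Set (Fin d)) := by simp
      have hun : (Set.univ : Set (Fin d)) = insert k {k}ᶜ := by
        ext i; simp [em]
      have hr1 : Ideal.span (Set.range y) = Ideal.span {X k} ⊔ Ideal.span (y '' {k}ᶜ) := by
        rw [← Set.image_univ, hun, Set.image_insert_eq, hyX k hk, Ideal.span_insert]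
      have hr2 : Ideal.span (Set.range (Function.update y k f)) =
          Ideal.span {f} ⊔ Ideal.span (y '' {k}ᶜ) := by
        rw [← Set.image_univ, hun, Set.image_insert_eq, himg _ hkc, Function.update_self,
          Ideal.span_insert]
      rw [hr1] at hdeg
      rw [hr2]
      obtain ⟨t, rfl⟩ : ∃ t, s = t + r := ⟨s - r, by omega⟩
      refine aux_degree k _ ?_ f (hU f hfU) (hf' _ hkc) _ hdeg t (by omega) p hp
      apply Ideal.homogeneous_span
      rintro _ ⟨i, hi, rfl⟩
      by_cases hiF : i ∈ F
      · exact ⟨r, hU _ (hyF i hiF)⟩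
      · rw [hyX i hiF]; exact ⟨1, isHomogeneous_X _ _⟩

lemma aux_ideal_top {d r : ℕ} (hd : 1 ≤ d) (hr : 1 ≤ r) {B : Set (MvPolynomial (Fin d) ℂ)}
    (hB : ∀ b ∈ B, b.IsHomogeneous r)
    (hBzero : ∀ x : Fin d → ℂ, (∀ b ∈ B, MvPolynomial.eval x b = 0) → x = 0)
    (N : ℕ) (hN : r * d ≤ N) (p : MvPolynomial (Fin d) ℂ) (hp : p.IsHomogeneous N) :
    p ∈ Ideal.span B := by
  obtain ⟨y, hy, -, -, h⟩ := aux_ideal hr hB hBzero Finset.univ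
  have h1 := h N (by
    rw [Finset.card_univ, Fintype.card_fin]
    obtain ⟨r, rfl⟩ : ∃ q, r = q + 1 := ⟨r - 1, by omega⟩
    simp only [Nat.add_sub_cancel]
    nlinarith) p hp
  refine (Ideal.span_le.2 ?_ : Ideal.span (Set.range y) ≤ Ideal.span B) h1
  rintro _ ⟨i, rfl⟩
  have : Submodule.span ℂ B ≤ (Ideal.span B).restrictScalars ℂ :=
    Submodule.span_le.2 Ideal.subset_span
  exact this (hy i (Finset.mem_univ i))

lemma aux_pderiv_comm {d : ℕ} (i j : Fin d) :
    ((pderiv i).toLinearMap : Module.End ℂ (MvPolynomial (Fin d) ℂ)) *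
      ((pderiv j).toLinearMap : Module.End ℂ (MvPolynomial (Fin d) ℂ))
      = ((pderiv j).toLinearMap : Module.End ℂ (MvPolynomial (Fin d) ℂ)) * (pderiv i).toLinearMap := by
  have h : ⁅(pderiv i : Derivation ℂ (MvPolynomial (Fin d) ℂ)
      (MvPolynomial (Fin d) ℂ)), (pderiv j : Derivation ℂ (MvPolynomial (Fin d) ℂ)
      (MvPolynomial (Fin d) ℂ))⁆ = 0 := by
    apply MvPolynomial.derivation_ext
    intro k
    rw [Derivation.commutator_apply, pderiv_X, pderiv_X]
    simp [Pi.single_apply]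
    split_ifs <;> simp
  refine LinearMap.ext fun p => ?_
  have h2 := DFunLike.congr_fun h p
  rw [Derivation.commutator_apply] at h2
  exact sub_eq_zero.1 h2

open scoped IsMulCommutative in
lemma aux_algHom (d : ℕ) : ∃ D : MvPolynomial (Fin d) ℂ →ₐ[ℂ]
    Module.End ℂ (MvPolynomial (Fin d) ℂ),
    (∀ i, D (X i) = (pderiv i).toLinearMap) ∧ ∀ b, diffOp d b = D b := by
  let s : Set (Module.End ℂ (MvPolynomial (Fin d) ℂ)) :=
    Set.range fun i => (pderiv i).toLinearMap
  have hs : ∀ a ∈ s, ∀ b ∈ s, a * b = b * a := by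
    rintro _ ⟨i, rfl⟩ _ ⟨j, rfl⟩
    exact aux_pderiv_comm i j
  have := Algebra.isMulCommutative_adjoin ℂ hs
  let g : Fin d → Algebra.adjoin ℂ s := fun i => ⟨_, Algebra.subset_adjoin ⟨i, rfl⟩⟩
  let D := (Algebra.adjoin ℂ s).val.comp (aeval g)
  have hX : ∀ i, D (X i) = (pderiv i).toLinearMap := by
    intro i
    simp [D, g]
  refine ⟨D, hX, fun b => ?_⟩
  conv_rhs => rw [b.as_sum, map_sum]
  apply Finset.sum_congr rfl
  intro m _
  rw [show monomial m (b.coeff m) = b.coeff m • monomial m 1 by simp [smul_monomial], map_smul]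
  congr 1
  have : (monomial m 1 : MvPolynomial (Fin d) ℂ) = (List.ofFn fun i => X i ^ m i).prod := by
    rw [List.prod_ofFn, monomial_eq, Finsupp.prod_fintype]
    · simp
    · simp
  rw [this, map_list_prod, List.map_ofFn]
  congr 2
  ext1 i
  simp only [Function.comp, map_pow, hX]

lemma aux_hom {d : ℕ} (D : MvPolynomial (Fin d) ℂ →ₐ[ℂ] Module.End ℂ (MvPolynomial (Fin d) ℂ))
    (hX : ∀ i, D (X i) = (pderiv i).toLinearMap) (r : ℕ) :
    ∀ (b : MvPolynomial (Fin d) ℂ), b.IsHomogeneous r →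
    ∀ (M : ℕ) (p : MvPolynomial (Fin d) ℂ), p.IsHomogeneous (M + r) → (D b p).IsHomogeneous M := by
  intro b hb
  have hmon : ∀ m : Fin d →₀ ℕ, ∀ (M : ℕ) (p : MvPolynomial (Fin d) ℂ),
      p.IsHomogeneous (M + m.degree) → (D (monomial m 1) p).IsHomogeneous M := by
    intro m
    induction m using Finsupp.induction_linear with
    | zero => intro M p hp; simpa using hp
    | add f g hf hg =>
      intro M p hp
      rw [show (monomial (f + g) 1 : MvPolynomial (Fin d) ℂ) = monomial f 1 * monomial g 1 by
        simp [monomial_mul], map_mul]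
      apply hf
      apply hg
      rwa [map_add, ← add_assoc] at hp
    | single i n =>
      rw [← X_pow_eq_monomial, map_pow, hX, Finsupp.degree_single]
      induction n with
      | zero => intro M p hp; simpa using hp
      | succ n ih =>
        intro M p hp
        rw [pow_succ]
        apply ih
        have := hp.pderiv (i := i)
        exact this
  intro M p hp
  rw [b.as_sum, map_sum, LinearMap.sum_apply]
  apply IsHomogeneous.sum
  intro m hm
  rw [show monomial m (b.coeff m) = b.coeff m • monomial m 1 by simp [smul_monomial], map_smul]
  apply (homogeneousSubmodule (Fin d) ℂ M).smul_mem
  apply hmon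
  have h1 := hb.degree_eq_sum_deg_support hm
  rw [h1] at hp
  exact hp

lemma aux_apolar {d : ℕ}
    (D : MvPolynomial (Fin d) ℂ →ₐ[ℂ] Module.End ℂ (MvPolynomial (Fin d) ℂ))
    (hX : ∀ i, D (X i) = (pderiv i).toLinearMap) (N : ℕ) :
    ∀ (f : MvPolynomial (Fin d) ℂ), f.IsHomogeneous N →
    (∀ p : MvPolynomial (Fin d) ℂ, p.IsHomogeneous N → D p f = 0) → f = 0 := by
  induction N with
  | zero =>
    intro f hf h
    simpa using h 1 (isHomogeneous_one _ _)
  | succ N ih =>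
    intro f hf h
    have h1 : ∀ i, pderiv i f = 0 := by
      intro i
      apply ih _ (by simpa using hf.pderiv (i := i))
      intro p hp
      have := h (p * X i) (hp.mul (isHomogeneous_X _ i))
      rw [map_mul, hX] at this
      exact this
    have h2 := hf.sum_X_mul_pderiv
    simp only [h1, mul_zero, Finset.sum_const_zero] at h2
    exact (smul_eq_zero.1 h2.symm).resolve_left (by simp)

/-- If `A` and `B` are sets of degree-`r` homogeneous polynomials in
`ℂ[X₁,…,X_d]`, each with the origin as only common zero, then for every
`N ≥ rd` some product `M_{a₁} ∘ b₁(∂) ∘ ⋯ ∘ M_{a_m} ∘ b_m(∂)` with `m ≥ 1`,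
`aᵢ ∈ A`, `bᵢ ∈ B`, restricted to the homogeneous polynomials of degree `N`,
is not nilpotent. -/
theorem exists_product_not_nilpotent (d r : ℕ) (hd : 1 ≤ d) (hr : 1 ≤ r)
    (A B : Set (MvPolynomial (Fin d) ℂ))
    (hA : ∀ a ∈ A, a.IsHomogeneous r) (hB : ∀ b ∈ B, b.IsHomogeneous r)
    (hAzero : ∀ x : Fin d → ℂ, (∀ a ∈ A, MvPolynomial.eval x a = 0) → x = 0)
    (hBzero : ∀ x : Fin d → ℂ, (∀ b ∈ B, MvPolynomial.eval x b = 0) → x = 0)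
    (N : ℕ) (hN : r * d ≤ N) :
    ∃ m : ℕ, 1 ≤ m ∧
      ∃ a b : Fin m → MvPolynomial (Fin d) ℂ,
        (∀ i, a i ∈ A) ∧ (∀ i, b i ∈ B) ∧
        ∃ h : ∀ p ∈ homogeneousSubmodule (Fin d) ℂ N,
            (List.ofFn fun i : Fin m =>
              LinearMap.mulLeft ℂ (a i) * diffOp d (b i)).prod p ∈
              homogeneousSubmodule (Fin d) ℂ N,
          ¬ IsNilpotent ((List.ofFn fun i : Fin m =>
              LinearMap.mulLeft ℂ (a i) * diffOp d (b i)).prod.restrict h) := by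
  obtain ⟨D, hX, hD⟩ := aux_algHom d
  have hrN : r ≤ N := le_trans (Nat.le_mul_of_pos_right r hd) hN
  let op : MvPolynomial (Fin d) ℂ × MvPolynomial (Fin d) ℂ →
    Module.End ℂ (MvPolynomial (Fin d) ℂ) := fun x => LinearMap.mulLeft ℂ x.1 * diffOp d x.2
  have hfd : FiniteDimensional ℂ (homogeneousSubmodule (Fin d) ℂ N) :=
    Module.Finite.iff_fg.2 (homogeneousSubmodule_fg _ _ N)
  have hnt : Nontrivial (homogeneousSubmodule (Fin d) ℂ N) := by
    refine ⟨⟨⟨X ⟨0, hd⟩ ^ N, isHomogeneous_X_pow _ _⟩, 0, fun h => ?_⟩⟩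
    have h1 := congrArg Subtype.val h
    exact pow_ne_zero N (X_ne_zero (R := ℂ) (⟨0, hd⟩ : Fin d)) h1
  obtain ⟨a₀, ha₀, ha₀0⟩ : ∃ a ∈ A, a ≠ 0 := by
    by_contra hc
    push Not at hc
    have h1 := hAzero (fun _ => 1) (fun a ha => by rw [hc a ha, map_zero])
    exact one_ne_zero (congrFun h1 ⟨0, hd⟩)
  by_contra hcon
  let P : Set (Module.End ℂ (homogeneousSubmodule (Fin d) ℂ N)) :=
    {T | ∃ l : List (MvPolynomial (Fin d) ℂ × MvPolynomial (Fin d) ℂ), l ≠ [] ∧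
      (∀ x ∈ l, x.1 ∈ A ∧ x.2 ∈ B) ∧
      ∀ v, (T v : MvPolynomial (Fin d) ℂ) = (l.map op).prod v}
  have hPmul : ∀ x ∈ P, ∀ y ∈ P, x * y ∈ P := by
    rintro x ⟨l, hl, hlm, hlv⟩ y ⟨l', hl', hlm', hlv'⟩
    refine ⟨l ++ l', by simp [hl], ?_, ?_⟩
    · intro z hz
      rcases List.mem_append.1 hz with hz | hz
      · exact hlm z hz
      · exact hlm' z hz
    · intro v
      rw [List.map_append, List.prod_append, Module.End.mul_apply, Module.End.mul_apply,
        hlv, hlv']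
  have hPnil : ∀ x ∈ P, IsNilpotent x := by
    rintro T ⟨l, hl, hlm, hlv⟩
    by_contra hn
    have hL : (List.ofFn fun i : Fin l.length =>
        LinearMap.mulLeft ℂ (l.get i).1 * diffOp d (l.get i).2) = l.map op := by
      conv_rhs => rw [← List.ofFn_get l, List.map_ofFn]
      rfl
    have h : ∀ p ∈ homogeneousSubmodule (Fin d) ℂ N,
        (List.ofFn fun i : Fin l.length =>
          LinearMap.mulLeft ℂ (l.get i).1 * diffOp d (l.get i).2).prod p ∈
          homogeneousSubmodule (Fin d) ℂ N := by
      intro p hp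
      rw [hL, ← hlv ⟨p, hp⟩]
      exact (T ⟨p, hp⟩).2
    refine hcon ⟨l.length, List.length_pos_iff.2 hl, fun i => (l.get i).1, fun i => (l.get i).2,
      fun i => (hlm _ (List.get_mem l i)).1, fun i => (hlm _ (List.get_mem l i)).2, h, ?_⟩
    have : (List.ofFn fun i : Fin l.length =>
          LinearMap.mulLeft ℂ (l.get i).1 * diffOp d (l.get i).2).prod.restrict h = T := by
      refine LinearMap.ext fun v => Subtype.ext ?_
      rw [LinearMap.coe_restrict_apply, hL, hlv]
    rw [this]
    exact hn
  obtain ⟨⟨v, hv⟩, hv0, hvP⟩ := aux_common_kernel P hPmul hPnil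
  have hBv : ∀ b ∈ B, D b v = 0 := by
    intro b hb
    have hmap : ∀ p ∈ homogeneousSubmodule (Fin d) ℂ N,
        op (a₀, b) p ∈ homogeneousSubmodule (Fin d) ℂ N := by
      intro p hp
      have h1 : (D b p).IsHomogeneous (N - r) :=
        aux_hom D hX r b (hB b hb) (N - r) p (by rwa [Nat.sub_add_cancel hrN])
      have h2 := (hA a₀ ha₀).mul h1
      rw [Nat.add_sub_cancel' hrN] at h2
      change (a₀ * diffOp d b p).IsHomogeneous N
      rwa [hD]
    have h3 := hvP ((op (a₀, b)).restrict hmap) ⟨[(a₀, b)], by simp, by simp [ha₀, hb], by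
      intro v; simp⟩
    have h4 : a₀ * diffOp d b v = 0 := congrArg Subtype.val h3
    rw [hD] at h4
    exact (mul_eq_zero.1 h4).resolve_left ha₀0
  refine hv0 (Subtype.ext (aux_apolar D hX N v hv fun p hp => ?_))
  have hpB := aux_ideal_top hd hr hB hBzero N hN p hp
  clear hp
  refine Submodule.span_induction (p := fun q _ => D q v = 0) hBv (by simp) ?_ ?_ hpB
  · intro x y _ _ hx hy
    rw [map_add, LinearMap.add_apply, hx, hy, add_zero]
  · intro a x _ hx
    rw [smul_eq_mul, map_mul, Module.End.mul_apply, hx, map_zero]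
end
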